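/- arXiv:2404.10750 — 2 statements merged into one kernel-verified Lean document; each statement's English description precedes it below -/
import Mathlib

section
/- Let k be a positive integer, set s = ⌈k/12⌉, let T be an antidirected tree with k arcs, and let D be a 𝒦_{2,s}-free digraph with n vertices and more than (k−1)·n arcs. If Δ₂(T) ≥ ⌊k/4⌋ + 3, then T embeds in D. -/
open Finset

section Defs

variable {V W : Type*}

/-- Number of arcs of a digraph given by a Boolean adjacency relation. -/
def arcCount [Fintype V] (A : V → V → Bool) : ℕ :=
  ((univ : Finset (V × V)).filter (fun p => A p.1 p.2)).card

/-- Out-neighbourhood. -/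
def outNbr [Fintype V] (A : V → V → Bool) (a : V) : Finset V :=
  univ.filter (fun v => A a v)

/-- In-neighbourhood. -/
def inNbr [Fintype V] (A : V → V → Bool) (a : V) : Finset V :=
  univ.filter (fun v => A v a)

/-- Neighbourhood with a sign: `true` = out, `false` = in. -/
def nbr [Fintype V] (A : V → V → Bool) (sign : Bool) (a : V) : Finset V :=
  if sign then outNbr A a else inNbr A a

/-- Total degree (out-degree plus in-degree). -/
def totalDeg [Fintype V] (A : V → V → Bool) (a : V) : ℕ :=
  (outNbr A a).card + (inNbr A a).card

/-- Maximum total degree `Δ`. -/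
def maxDeg [Fintype V] (A : V → V → Bool) : ℕ :=
  univ.sup (totalDeg A)

/-- Second largest element `Δ₂` of the multiset of total degrees. -/
def secondMaxDeg [Fintype V] (A : V → V → Bool) : ℕ :=
  (((univ : Finset V).val.map (totalDeg A)).erase (maxDeg A)).sup

/-- Loopless digraph. -/
def Loopless (A : V → V → Bool) : Prop := ∀ v, ¬ A v v

/-- Antidirected digraph: no directed path with two arcs. -/
def Antidirected (A : V → V → Bool) : Prop := ∀ x y z, A x y → A y z → False

/-- The underlying (undirected) simple graph of a digraph. -/
def underG (A : V → V → Bool) : SimpleGraph V :=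
  SimpleGraph.fromRel (fun x y => A x y)

/-- `𝒦_{2,s}`-freeness: no two distinct vertices `a`, `b` together with signs and `s`
distinct vertices (all different from `a` and `b`) lying in both signed neighbourhoods. -/
def K2sFree [Fintype V] [DecidableEq V] (A : V → V → Bool) (s : ℕ) : Prop :=
  ¬ ∃ (a b : V) (sa sb : Bool) (S : Finset V), a ≠ b ∧ S.card = s ∧
      a ∉ S ∧ b ∉ S ∧ S ⊆ nbr A sa a ∩ nbr A sb b

/-- `T` embeds in `A`: there is an injective arc-preserving map. -/
def Embeds (T : W → W → Bool) (A : V → V → Bool) : Prop :=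
  ∃ f : W → V, Function.Injective f ∧ ∀ x y, T x y → A (f x) (f y)

/-- Vertices of positive out-degree. -/
def outVerts [Fintype V] (A : V → V → Bool) : Finset V :=
  univ.filter (fun v => (outNbr A v).card ≠ 0)

/-- Vertices of positive in-degree. -/
def inVerts [Fintype V] (A : V → V → Bool) : Finset V :=
  univ.filter (fun v => (inNbr A v).card ≠ 0)

/-- A caterpillar: a tree with a path such that every vertex is on the path
or adjacent to it. -/
def IsCaterpillarG {X : Type*} (G : SimpleGraph X) : Prop :=
  G.IsTree ∧ ∃ (x y : X) (P : G.Walk x y), P.IsPath ∧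
    ∀ v, v ∈ P.support ∨ ∃ w ∈ P.support, G.Adj v w

/-- Minimum pseudo-semidegree at least `m`: at least one arc, and every
out-degree and in-degree is `0` or at least `m`. -/
def MinPseudoSemidegGe [Fintype V] (A : V → V → Bool) (m : ℕ) : Prop :=
  0 < arcCount A ∧ (∀ v, (outNbr A v).card = 0 ∨ m ≤ (outNbr A v).card) ∧
    (∀ v, (inNbr A v).card = 0 ∨ m ≤ (inNbr A v).card)

/-- `D'` is a subdigraph of `D` with vertex set `S`. -/
def SubdigraphOn (D : V → V → Bool) (S : Finset V) (D' : V → V → Bool) : Prop :=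
  ∀ x y, D' x y → D x y ∧ x ∈ S ∧ y ∈ S

/-- The vertex set of the double broom `B_{uv}(T)`: the path joining `u` and `v`
together with all neighbours of `u` and all neighbours of `v`. -/
def broomSet [Fintype W] [DecidableEq W] (T : W → W → Bool) {u v : W}
    (p : (underG T).Walk u v) : Finset W :=
  p.support.toFinset ∪ (outNbr T u ∪ inNbr T u) ∪ (outNbr T v ∪ inNbr T v)

/-- `z` lies strictly after `x` and strictly before `y` in clockwise (cyclic) order
on `Fin n`. -/
def cycBetween {n : ℕ} (x y z : Fin n) : Prop :=
  if x < y then x < z ∧ z < y else x < z ∨ z < y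

/-- An arc `pq` of the convex digraph `A` on `Fin n` is good for the antidirected
caterpillar `T` with final vertex `u`, its spine neighbour `v`, and spine with
`plen` edges (so `plen + 1` spine vertices). -/
def GoodArc {n : ℕ} (A : Fin n → Fin n → Bool) (T : W → W → Bool)
    (u v : W) (plen : ℕ) (pq : Fin n × Fin n) : Prop :=
  ∃ f : W → Fin n, Function.Injective f ∧ (∀ x y, T x y → A (f x) (f y)) ∧
    ((T v u = true ∧ (f v, f u) = pq) ∨ (T u v = true ∧ (f u, f v) = pq)) ∧
    (∀ z : Fin n,
      (plen % 2 = 0 → cycBetween (f u) (f v) z → z ∉ Set.range f) ∧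
      (plen % 2 = 1 → z ≠ f u → z ≠ f v → ¬ cycBetween (f u) (f v) z →
        z ∉ Set.range f))

/-- Number of edges of a bipartite graph with parts `α`, `β`. -/
def bipArcCount {α β : Type*} [Fintype α] [Fintype β] (E : α → β → Bool) : ℕ :=
  ((univ : Finset (α × β)).filter (fun p => E p.1 p.2)).card

/-- Degree of a vertex of the `α` part. -/
def bipDegA {α β : Type*} [Fintype β] (E : α → β → Bool) (a : α) : ℕ :=
  (univ.filter (fun b => E a b)).card

/-- Degree of a vertex of the `β` part. -/
def bipDegB {α β : Type*} [Fintype α] (E : α → β → Bool) (b : β) : ℕ :=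
  (univ.filter (fun a => E a b)).card

end Defs

section Rooted

variable {W : Type*}

/-- A graph rooted at `r`: `depth` and `par` record the distance to the root and the parent,
and every edge joins a vertex to its parent. -/
structure IsRooted (G : SimpleGraph W) (r : W) (par : W → W) (depth : W → ℕ) : Prop where
  depth_root : depth r = 0
  adj_par : ∀ y, y ≠ r → G.Adj y (par y)
  depth_par : ∀ y, y ≠ r → depth y = depth (par y) + 1
  of_adj : ∀ x y, G.Adj x y → (x ≠ r ∧ y = par x) ∨ (y ≠ r ∧ x = par y)

variable {G : SimpleGraph W} {r : W} {par : W → W} {depth : W → ℕ}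

theorem IsRooted.depth_iterate (h : IsRooted G r par depth) (e : W) :
    ∀ i ≤ depth e, depth (par^[i] e) = depth e - i := by
  intro i
  induction i with
  | zero => simp
  | succ i ih =>
    intro hi
    have h1 := ih (by omega)
    have hne : par^[i] e ≠ r := by
      intro hr
      rw [hr, h.depth_root] at h1
      omega
    have h2 := h.depth_par _ hne
    rw [Function.iterate_succ_apply']
    omega

theorem IsRooted.eq_root_of_depth (h : IsRooted G r par depth) {y : W} (hy : depth y = 0) :
    y = r := by
  by_contra hne
  have := h.depth_par y hne
  omega

theorem IsRooted.exists_par_eq_root (hrt : IsRooted G r par depth) {R : Finset W}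
    (hR : ∀ y ∈ R, y ≠ r → par y ∈ R) (n : ℕ) :
    ∀ x ∈ R, x ≠ r → depth x = n → ∃ z ∈ R, z ≠ r ∧ par z = r := by
  induction n with
  | zero => intro x _ hxr hx; exact absurd (hrt.eq_root_of_depth hx) hxr
  | succ n ih =>
    intro x hx hxr hn
    by_cases hp : par x = r
    · exact ⟨x, hx, hxr, hp⟩
    · exact ih _ (hR x hx hxr) hp (by have := hrt.depth_par x hxr; omega)

end Rooted

section Trees

variable {W : Type*} [Fintype W] [DecidableEq W]

theorem exists_isRooted_of_isTree {G : SimpleGraph W} (hG : G.IsTree) (r : W) :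
    ∃ par, IsRooted G r par (fun y => G.dist r y) := by
  classical
  have hpar : ∀ y, ∃ z, y ≠ r → G.Adj y z ∧ G.dist r y = G.dist r z + 1 := by
    intro y
    by_cases hy : y = r
    · exact ⟨y, fun h => absurd hy h⟩
    obtain ⟨w, hw⟩ := hG.connected.exists_walk_length_eq_dist y r
    cases w with
    | nil => exact absurd rfl hy
    | cons h q =>
      rename_i z
      refine ⟨z, fun _ => ⟨h, ?_⟩⟩
      have h1 := G.dist_le q
      have h2 := hG.connected.dist_triangle (u := y) (v := z) (w := r)
      have h3 : G.dist y z = 1 := SimpleGraph.dist_eq_one_iff_adj.2 h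
      rw [SimpleGraph.Walk.length_cons] at hw
      rw [G.dist_comm (u := r), G.dist_comm (u := r)]
      omega
  choose par hpar using hpar
  refine ⟨par, by simp, fun y hy => (hpar y hy).1, fun y hy => (hpar y hy).2, ?_⟩
  have hinj : Set.InjOn (fun y => s(y, par y)) (univ.erase r : Finset W) := by
    intro x hx y hy hxy
    have hx' := hpar x (by simpa using hx)
    have hy' := hpar y (by simpa using hy)
    rcases Sym2.eq_iff.1 hxy with h | ⟨h1, h2⟩
    · exact h.1
    · have h3 := hx'.2
      have h4 := hy'.2
      rw [h2] at h3
      rw [← h1] at h4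
      omega
  have himg : (univ.erase r).image (fun y => s(y, par y)) = G.edgeFinset := by
    apply Finset.eq_of_subset_of_card_le
    · intro e he
      obtain ⟨y, hy, rfl⟩ := Finset.mem_image.1 he
      simpa using (hpar y (by simpa using hy)).1
    · rw [Finset.card_image_of_injOn hinj, Finset.card_erase_of_mem (mem_univ r), card_univ]
      have := hG.card_edgeFinset
      omega
  intro x y hxy
  have : s(x, y) ∈ (univ.erase r).image (fun y => s(y, par y)) := by
    rw [himg]; simpa using hxy
  obtain ⟨z, hz, hzz⟩ := Finset.mem_image.1 this
  have hz' : z ≠ r := by simpa using hz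
  rcases Sym2.eq_iff.1 hzz with ⟨rfl, rfl⟩ | ⟨rfl, rfl⟩
  · exact Or.inl ⟨hz', rfl⟩
  · exact Or.inr ⟨hz', rfl⟩

namespace IsRooted

variable {G : SimpleGraph W} {r : W} {par : W → W} {depth : W → ℕ}

variable [DecidableRel G.Adj]

/-- The parent of a vertex is never a leaf. -/
theorem two_le_degree_par (h : IsRooted G r par depth) (hr : 2 ≤ G.degree r) {y : W}
    (hy : y ≠ r) : 2 ≤ G.degree (par y) := by
  by_cases hp : par y = r
  · rwa [hp]
  · rw [← G.card_neighborFinset_eq_degree]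
    have hne : y ≠ par (par y) := by
      intro he
      have h1 := h.depth_par y hy
      have h2 := h.depth_par _ hp
      rw [← he] at h2
      omega
    rw [← Finset.card_pair hne]
    apply Finset.card_le_card
    intro z hz
    rcases Finset.mem_insert.1 hz with rfl | hz
    · simpa using (h.adj_par _ hy).symm
    · rw [Finset.mem_singleton.1 hz]
      simpa using h.adj_par _ hp

end IsRooted

/-- The number of leaves of a tree is at least `2` plus the sum of `deg - 2` over any set of
vertices of degree at least two. -/
theorem two_mul_add_sum_degree_le {G : SimpleGraph W} [DecidableRel G.Adj] (hG : G.IsTree)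
    (hW : 2 ≤ Fintype.card W) (X : Finset W) (hX : ∀ x ∈ X, 2 ≤ G.degree x) :
    2 + ∑ x ∈ X, G.degree x ≤
      (univ.filter (fun x => ¬ 2 ≤ G.degree x)).card + 2 * X.card := by
  classical
  have hsum := G.sum_degrees_eq_twice_card_edges
  have hedge := hG.card_edgeFinset
  have hpos : ∀ x, 1 ≤ G.degree x := by
    have : Nontrivial W := Fintype.one_lt_card_iff_nontrivial.1 hW
    intro x
    exact hG.connected.preconnected.degree_pos_of_nontrivial x
  have hsplit := Finset.sum_filter_add_sum_filter_not univ
    (fun x => 2 ≤ G.degree x) (fun x => G.degree x)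
  have hcard := Finset.card_filter_add_card_filter_not (s := (univ : Finset W))
    (fun x => 2 ≤ G.degree x)
  have hleaf : (univ.filter (fun x => ¬ 2 ≤ G.degree x)).card ≤
      ∑ x ∈ univ.filter (fun x => ¬ 2 ≤ G.degree x), G.degree x := by
    rw [Finset.card_eq_sum_ones]
    exact Finset.sum_le_sum fun x _ => hpos x
  have hsub : X ⊆ univ.filter (fun x => 2 ≤ G.degree x) := fun x hx => by simp [hX x hx]
  have hrest := Finset.sum_sdiff (f := fun x => G.degree x) hsub
  have hrestc := Finset.card_sdiff_add_card_eq_card hsub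
  have hr : 2 * (univ.filter (fun x => 2 ≤ G.degree x) \ X).card ≤
      ∑ x ∈ univ.filter (fun x => 2 ≤ G.degree x) \ X, G.degree x := by
    rw [mul_comm, ← smul_eq_mul]
    apply Finset.card_nsmul_le_sum
    intro x hx
    simpa using (Finset.mem_sdiff.1 hx).1
  rw [card_univ] at hcard
  omega

end Trees

section SignedNeighbourhoods

variable {V : Type*} [DecidableEq V]

/-- Neighbourhoods in the bipartite double cover of a loopless digraph, where neighbourhoods of
distinct vertices, with any signs, share at most `t` vertices, and nonempty neighbourhoods have
at least `m` vertices. -/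
structure SparseNbr (Nb : Bool → V → Finset V) (t m : ℕ) : Prop where
  symm : ∀ s x w, w ∈ Nb s x → x ∈ Nb (!s) w
  irrefl : ∀ s x, x ∉ Nb s x
  codeg : ∀ s s' x x', x ≠ x' → (Nb s x ∩ Nb s' x').card ≤ t
  min_le : ∀ s x, (Nb s x).Nonempty → m ≤ (Nb s x).card

namespace SparseNbr

variable {Nb : Bool → V → Finset V} {t m : ℕ}

/-- Double counting: some vertex of `C`, a set of neighbours of `y`, has few neighbours
in `insert y P`. -/
theorem exists_few_nbrs (hN : SparseNbr Nb t m) (s : Bool) (y : V) (P C : Finset V) (i : ℕ)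
    (hy : y ∉ P) (hP : P.card = i) (hC : C ⊆ Nb s y) (hcard : 2 * t + 1 ≤ C.card) :
    ∃ b ∈ C, 2 * (Nb (!s) b ∩ insert y P).card ≤ i + 2 := by
  by_contra! hcon
  have hdc : ∑ b ∈ C, (Nb (!s) b ∩ insert y P).card
      = ∑ x ∈ insert y P, (C ∩ Nb s x).card := by
    have := Finset.sum_card_bipartiteAbove_eq_sum_card_bipartiteBelow
      (s := C) (t := insert y P) (fun b x => x ∈ Nb (!s) b)
    calc _ = _ := Finset.sum_congr rfl fun b _ => by
            rw [Finset.inter_comm, ← Finset.filter_mem_eq_inter]; rfl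
      _ = _ := this
      _ = _ := Finset.sum_congr rfl fun x _ => by
            rw [← Finset.filter_mem_eq_inter, Finset.bipartiteBelow]
            congr 1
            apply Finset.filter_congr
            intro b _
            exact ⟨fun h => by simpa using hN.symm _ _ _ h, hN.symm _ _ _⟩
  rw [Finset.sum_insert hy] at hdc
  have h1 : (C ∩ Nb s y).card ≤ C.card := Finset.card_le_card Finset.inter_subset_left
  have h2 : ∑ x ∈ P, (C ∩ Nb s x).card ≤ i * t := by
    rw [← hP, ← smul_eq_mul]
    apply Finset.sum_le_card_nsmul
    intro x hx
    refine le_trans (Finset.card_le_card (Finset.inter_subset_inter_right hC)) ?_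
    exact hN.codeg _ _ _ _ (by rintro rfl; exact hy hx)
  have h3 : C.card * (i + 3) ≤ ∑ b ∈ C, 2 * (Nb (!s) b ∩ insert y P).card := by
    rw [← smul_eq_mul]
    exact Finset.card_nsmul_le_sum _ _ _ fun b hb => hcon b hb
  rw [← Finset.mul_sum, hdc] at h3
  nlinarith

/-- There is an alternating path from `c` that meets the neighbourhood of `c` only in its second
vertex, and such that the neighbourhood of its last vertex contains at most about half of it. -/
theorem exists_spread_path (hN : SparseNbr Nb t m) {h : ℕ} (hm : 3 * t + h + 2 ≤ m)
    (σ : ℕ → Bool) (hσ : ∀ j, σ (j + 1) = !σ j) (c : V) (hc : (Nb (σ 0) c).Nonempty) :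
    ∀ i ≤ 2 * h + 2, ∃ g : ℕ → V, g 0 = c ∧ (∀ j l, j ≤ i → l ≤ i → g j = g l → j = l) ∧
      (∀ j < i, g (j + 1) ∈ Nb (σ j) (g j)) ∧
      (∀ j, 2 ≤ j → j ≤ i → g j ∉ Nb (σ 0) c) ∧
      2 * (Nb (σ i) (g i) ∩ (range i).image g).card ≤ i + 1 := by
  intro i
  induction i with
  | zero =>
    intro _
    refine ⟨fun _ => c, rfl, by omega, by omega, by omega, by simp⟩
  | succ i ih =>
    intro hi
    obtain ⟨g, hg0, hinj, hadj, havoid, hfew⟩ := ih (by omega)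
    have hne : (Nb (σ i) (g i)).Nonempty := by
      rcases Nat.eq_zero_or_pos i with rfl | hpos
      · rwa [hg0]
      · obtain ⟨j, rfl⟩ := Nat.exists_eq_add_of_lt hpos
        have := hN.symm _ _ _ (hadj (0 + j) (by omega))
        rw [← hσ] at this
        exact ⟨_, this⟩
    have hdeg := hN.min_le _ _ hne
    set P := (range i).image g with hPdef
    have hgP : g i ∉ P := by
      intro hmem
      obtain ⟨j, hj, hji⟩ := Finset.mem_image.1 hmem
      have hj' := Finset.mem_range.1 hj
      have := hinj j i (by omega) le_rfl hji
      omega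
    have hPcard : P.card = i := by
      rw [hPdef, Finset.card_image_of_injOn, Finset.card_range]
      intro a ha b hb hab
      have ha' : a < i := by simpa using ha
      have hb' : b < i := by simpa using hb
      exact hinj a b (by omega) (by omega) hab
    set Q := if i = 0 then (∅ : Finset V) else Nb (σ i) (g i) ∩ Nb (σ 0) c with hQdef
    have hQcard : Q.card ≤ t := by
      rw [hQdef]
      split_ifs with h0
      · simp
      · apply hN.codeg
        rw [← hg0]
        intro he
        have := hinj i 0 le_rfl (by omega) he
        omega
    have hCcard : 2 * t + 1 ≤ ((Nb (σ i) (g i) \ (Nb (σ i) (g i) ∩ P)) \ Q).card := by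
      have h1 := Finset.le_card_sdiff Q (Nb (σ i) (g i) \ (Nb (σ i) (g i) ∩ P))
      have h2 := Finset.le_card_sdiff (Nb (σ i) (g i) ∩ P) (Nb (σ i) (g i))
      omega
    obtain ⟨b, hb, hbfew⟩ := hN.exists_few_nbrs (σ i) (g i) P _ i hgP hPcard
      ((Finset.sdiff_subset).trans Finset.sdiff_subset) hCcard
    have hb1 : b ∈ Nb (σ i) (g i) := by
      simp only [Finset.mem_sdiff] at hb; exact hb.1.1
    have hbP : b ∉ P := by
      simp only [Finset.mem_sdiff, Finset.mem_inter] at hb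
      exact fun hh => hb.1.2 ⟨hb1, hh⟩
    have hbg : b ≠ g i := by rintro rfl; exact hN.irrefl _ _ hb1
    have hbQ : b ∉ Q := (Finset.mem_sdiff.1 hb).2
    have hbj : ∀ j ≤ i, b ≠ g j := by
      intro j hj he
      rcases Nat.lt_or_eq_of_le hj with hlt | rfl
      · exact hbP (he ▸ Finset.mem_image_of_mem g (Finset.mem_range.2 hlt))
      · exact hbg he
    refine ⟨Function.update g (i + 1) b, ?_, ?_, ?_, ?_, ?_⟩
    · rw [Function.update_of_ne (by omega), hg0]
    · intro j l hj hl hjl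
      by_cases hj1 : j = i + 1 <;> by_cases hl1 : l = i + 1
      · omega
      · rw [hj1, Function.update_self, Function.update_of_ne hl1] at hjl
        exact absurd hjl (hbj l (by omega))
      · rw [hl1, Function.update_self, Function.update_of_ne hj1] at hjl
        exact absurd hjl.symm (hbj j (by omega))
      · rw [Function.update_of_ne hl1, Function.update_of_ne hj1] at hjl
        exact hinj j l (by omega) (by omega) hjl
    · intro j hj
      rw [Function.update_of_ne (by omega : j ≠ i + 1)]
      by_cases hji : j = i
      · rw [hji, Function.update_self]; exact hb1
      · rw [Function.update_of_ne (by omega)]; exact hadj j (by omega)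
    · intro j hj2 hj
      by_cases hji : j = i + 1
      · rw [hji, Function.update_self]
        intro hbc
        apply hbQ
        rw [hQdef, if_neg (by omega)]
        exact Finset.mem_inter.2 ⟨hb1, hbc⟩
      · rw [Function.update_of_ne hji]; exact havoid j hj2 (by omega)
    · have himg : (range (i + 1)).image (Function.update g (i + 1) b) = insert (g i) P := by
        rw [Finset.range_add_one, Finset.image_insert, Function.update_of_ne (by omega)]
        congr 1
        apply Finset.image_congr
        intro j hj
        have : j < i := by simpa using hj
        exact Function.update_of_ne (by omega) _ _
      rw [himg, Function.update_self, hσ]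
      exact hbfew

end SparseNbr

end SignedNeighbourhoods

section Skeleton

variable {V W : Type*} [DecidableEq V]

/-- The image of `S` meets `Z` in at most `∑ y ∈ S, wt y + h` vertices, or has at least `K`
vertices outside `Z`. -/
def Spread (Z : Finset V) (wt : W → ℕ) (h K : ℕ) (S : Finset W) (f : W → V) : Prop :=
  (S.image f ∩ Z).card ≤ ∑ y ∈ S, wt y + h ∨ K ≤ (S.image f \ Z).card

theorem Spread.mono {Z : Finset V} {wt : W → ℕ} {h h' K : ℕ} {S : Finset W}
    {f : W → V} (hs : Spread Z wt h K S f) (hh : h ≤ h') : Spread Z wt h' K S f :=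
  hs.imp_left fun hs => hs.trans (by omega)

variable [DecidableEq W]

theorem image_insert_update {S : Finset W} {y : W} (hy : y ∉ S) (f : W → V) (x : V) :
    (insert y S).image (Function.update f y x) = insert x (S.image f) := by
  rw [Finset.image_insert, Function.update_self]
  congr 1
  apply Finset.image_congr
  intro z hz
  exact Function.update_of_ne (by rintro rfl; exact hy hz) _ _

theorem Spread.insert_update {Z : Finset V} {wt : W → ℕ} {h K : ℕ} {S : Finset W} {f : W → V}
    (hs : Spread Z wt h K S f) {y : W} (hy : y ∉ S) {x : V}
    (hx : x ∉ Z ∨ 1 ≤ wt y ∨ K ≤ (S.image f \ Z).card) :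
    Spread Z wt h K (insert y S) (Function.update f y x) := by
  have hmono : S.image f \ Z ⊆ (insert x (S.image f)) \ Z :=
    Finset.sdiff_subset_sdiff (Finset.subset_insert _ _) le_rfl
  have hle := Finset.card_le_card hmono
  unfold Spread
  rw [image_insert_update hy, Finset.sum_insert hy]
  rcases hs with hs | hs
  · rcases hx with hx | hx | hx
    · left
      rw [Finset.insert_inter_of_notMem hx]
      omega
    · left
      have h1 : (insert x (S.image f) ∩ Z).card ≤ (insert x (S.image f ∩ Z)).card := by
        apply Finset.card_le_card
        intro z hz
        simp only [Finset.mem_inter, Finset.mem_insert] at hz ⊢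
        tauto
      have h2 := Finset.card_insert_le x (S.image f ∩ Z)
      omega
    · exact Or.inr (hx.trans hle)
  · exact Or.inr (hs.trans hle)

/-- `f` embeds the ancestor-closed set `S` of vertices of a rooted tree. -/
structure PartialEmb (Nb : Bool → V → Finset V) (side : W → Bool) (r : W) (par : W → W)
    (S : Finset W) (f : W → V) : Prop where
  root_mem : r ∈ S
  root_nonempty : (Nb (side r) (f r)).Nonempty
  par_mem : ∀ y ∈ S, y ≠ r → par y ∈ S
  injOn : Set.InjOn f S
  adj : ∀ y ∈ S, y ≠ r → f y ∈ Nb (side (par y)) (f (par y))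

variable {Nb : Bool → V → Finset V} {t m : ℕ} {side : W → Bool} {r : W} {par : W → W}
  {S : Finset W} {f : W → V}

theorem PartialEmb.nonempty (hf : PartialEmb Nb side r par S f) (hN : SparseNbr Nb t m)
    (hside : ∀ y, y ≠ r → side y = !side (par y)) {y : W} (hy : y ∈ S) :
    (Nb (side y) (f y)).Nonempty := by
  by_cases hyr : y = r
  · rw [hyr]; exact hf.root_nonempty
  · rw [hside y hyr]
    exact ⟨_, hN.symm _ _ _ (hf.adj y hy hyr)⟩

theorem PartialEmb.insert_update (hf : PartialEmb Nb side r par S f)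
    {y : W} (hy : y ∉ S) (hpy : par y ∈ S) (hpS : ∀ z ∈ S, z ≠ r → par z ≠ y)
    {x : V} (hx : x ∈ Nb (side (par y)) (f (par y))) (hxS : x ∉ S.image f) :
    PartialEmb Nb side r par (insert y S) (Function.update f y x) := by
  have hupd : ∀ z ∈ S, Function.update f y x z = f z := fun z hz =>
    Function.update_of_ne (by rintro rfl; exact hy hz) _ _
  refine ⟨Finset.mem_insert_of_mem hf.root_mem, ?_, ?_, ?_, ?_⟩
  · rw [hupd r hf.root_mem]; exact hf.root_nonempty
  · intro z hz hzr
    rcases Finset.mem_insert.1 hz with rfl | hz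
    · exact Finset.mem_insert_of_mem hpy
    · exact Finset.mem_insert_of_mem (hf.par_mem z hz hzr)
  · rw [Finset.coe_insert, Set.injOn_insert (by simpa using hy)]
    constructor
    · intro a ha b hb hab
      rw [hupd a ha, hupd b hb] at hab
      exact hf.injOn ha hb hab
    · rintro ⟨z, hz, hzx⟩
      rw [Function.update_self, hupd z hz] at hzx
      exact hxS (Finset.mem_image.2 ⟨z, hz, hzx⟩)
  · intro z hz hzr
    rcases Finset.mem_insert.1 hz with rfl | hz
    · rw [Function.update_self, hupd _ hpy]; exact hx
    · rw [hupd z hz, hupd _ (hf.par_mem z hz hzr)]; exact hf.adj z hz hzr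

/-- A partial embedding can be extended to any ancestor-closed set `R` of at most `m + 1`
vertices while staying spread out with respect to the neighbourhoods of two given vertices. -/
theorem PartialEmb.extend (hN : SparseNbr Nb t m) {depth : W → ℕ}
    (hdepth : ∀ y, y ≠ r → depth y = depth (par y) + 1)
    (hside : ∀ y, y ≠ r → side y = !side (par y)) {R : Finset W}
    (hR : ∀ y ∈ R, y ≠ r → par y ∈ R) (hRcard : R.card ≤ m + 1)
    {u v : W} {wu wv : W → ℕ}
    (hwu : ∀ y, y ≠ r → par y = u → 1 ≤ wu y) (hwv : ∀ y, y ≠ r → par y = v → 1 ≤ wv y)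
    {a b : V} {hu hv h : ℕ} (n : ℕ) :
    ∀ (S : Finset W) (f : W → V), S ⊆ R → (R \ S).card = n → u ∈ S → v ∈ S → f u = a → f v = b →
      PartialEmb Nb side r par S f →
      Spread (Nb (side u) a) wu hu (m - 2 * t) S f →
      Spread (Nb (side v) b) wv hv (m - 2 * t) S f →
      Spread (Nb (side u) a ∪ Nb (side v) b) (fun y => wu y + wv y) h (m - 2 * t) S f →
      ∃ f' : W → V, f' u = a ∧ f' v = b ∧ PartialEmb Nb side r par R f' ∧
        Spread (Nb (side u) a) wu hu (m - 2 * t) R f' ∧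
        Spread (Nb (side v) b) wv hv (m - 2 * t) R f' ∧
        Spread (Nb (side u) a ∪ Nb (side v) b) (fun y => wu y + wv y) h (m - 2 * t) R f' := by
  induction n with
  | zero =>
    intro S f hSR hn _ _ hfu hfv hf h1 h2 h3
    have : S = R := Finset.Subset.antisymm hSR
      (Finset.sdiff_eq_empty_iff_subset.1 (Finset.card_eq_zero.1 hn))
    subst this
    exact ⟨f, hfu, hfv, hf, h1, h2, h3⟩
  | succ n ih =>
    intro S f hSR hn huS hvS hfu hfv hf h1 h2 h3
    obtain ⟨y, hy, hymin⟩ := Finset.exists_min_image (R \ S) depth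
      (Finset.card_pos.1 (by omega))
    obtain ⟨hyR, hyS⟩ := Finset.mem_sdiff.1 hy
    have hyr : y ≠ r := by rintro rfl; exact hyS hf.root_mem
    have hpy : par y ∈ S := by
      by_contra hp
      have := hymin _ (Finset.mem_sdiff.2 ⟨hR y hyR hyr, hp⟩)
      have := hdepth y hyr
      omega
    set N := Nb (side (par y)) (f (par y)) with hNdef
    have hNm : m ≤ N.card := hN.min_le _ _ (hf.nonempty hN hside hpy)
    set A := Nb (side u) a with hA
    set B := Nb (side v) b with hB
    have hNA : par y ≠ u → (N ∩ A).card ≤ t := fun hne => hN.codeg _ _ _ _ fun he =>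
      hne (hf.injOn hpy huS (he.trans hfu.symm))
    have hNB : par y ≠ v → (N ∩ B).card ≤ t := fun hne => hN.codeg _ _ _ _ fun he =>
      hne (hf.injOn hpy hvS (he.trans hfv.symm))
    have hchoose : ∀ Z : Finset V, (N ∩ Z).card ≤ 2 * t →
        ∃ x ∈ N, x ∉ S.image f ∧ (x ∉ Z ∨ m - 2 * t ≤ (S.image f \ Z).card) := by
      intro Z hZ
      by_cases hfree : ∃ x ∈ N, x ∉ S.image f ∧ x ∉ Z
      · obtain ⟨x, hx, hxS, hxZ⟩ := hfree
        exact ⟨x, hx, hxS, Or.inl hxZ⟩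
      · push Not at hfree
        have hsub : N \ (N ∩ Z) ⊆ S.image f \ Z := by
          intro x hx
          simp only [Finset.mem_sdiff, Finset.mem_inter, not_and] at hx
          have hxZ := hx.2 hx.1
          refine Finset.mem_sdiff.2 ⟨?_, hxZ⟩
          by_contra hxS
          exact hxZ (hfree x hx.1 hxS)
        have hcard := Finset.card_le_card hsub
        have hcard' := Finset.le_card_sdiff (N ∩ Z) N
        have hlt : S.card < R.card := by
          have := Finset.card_sdiff_add_card_eq_card hSR
          omega
        have hex : ((S.image f).erase (f (par y))).card < N.card := by
          rw [Finset.card_erase_of_mem (Finset.mem_image_of_mem f hpy),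
            Finset.card_image_of_injOn hf.injOn]
          have := Finset.card_pos.2 ⟨_, hpy⟩
          omega
        obtain ⟨x, hx, hxS⟩ := Finset.exists_mem_notMem_of_card_lt_card hex
        refine ⟨x, hx, ?_, Or.inr (by omega)⟩
        intro hxS'
        exact hxS (Finset.mem_erase.2 ⟨by rintro rfl; exact hN.irrefl _ _ hx, hxS'⟩)
    have hmonoA : (S.image f \ (A ∪ B)).card ≤ (S.image f \ A).card :=
      Finset.card_le_card (Finset.sdiff_subset_sdiff le_rfl Finset.subset_union_left)
    have hmonoB : (S.image f \ (A ∪ B)).card ≤ (S.image f \ B).card :=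
      Finset.card_le_card (Finset.sdiff_subset_sdiff le_rfl Finset.subset_union_right)
    obtain ⟨x, hx, hxS, hxA, hxB, hxAB⟩ : ∃ x ∈ N, x ∉ S.image f ∧
        (x ∉ A ∨ 1 ≤ wu y ∨ m - 2 * t ≤ (S.image f \ A).card) ∧
        (x ∉ B ∨ 1 ≤ wv y ∨ m - 2 * t ≤ (S.image f \ B).card) ∧
        (x ∉ A ∪ B ∨ 1 ≤ wu y + wv y ∨ m - 2 * t ≤ (S.image f \ (A ∪ B)).card) := by
      by_cases hpu : par y = u
      · have hw := hwu y hyr hpu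
        by_cases hpv : par y = v
        · have hw' := hwv y hyr hpv
          obtain ⟨x, hx, hxS, -⟩ := hchoose ∅ (by simp)
          exact ⟨x, hx, hxS, Or.inr (Or.inl hw), Or.inr (Or.inl hw'), Or.inr (Or.inl (by omega))⟩
        · obtain ⟨x, hx, hxS, hxB⟩ := hchoose B ((hNB hpv).trans (by omega))
          exact ⟨x, hx, hxS, Or.inr (Or.inl hw), by tauto, Or.inr (Or.inl (by omega))⟩
      · by_cases hpv : par y = v
        · have hw := hwv y hyr hpv
          obtain ⟨x, hx, hxS, hxA⟩ := hchoose A ((hNA hpu).trans (by omega))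
          exact ⟨x, hx, hxS, by tauto, Or.inr (Or.inl hw), Or.inr (Or.inl (by omega))⟩
        · have hZ : (N ∩ (A ∪ B)).card ≤ 2 * t := by
            rw [Finset.inter_union_distrib_left]
            have := Finset.card_union_le (N ∩ A) (N ∩ B)
            have := hNA hpu
            have := hNB hpv
            omega
          obtain ⟨x, hx, hxS, hxZ⟩ := hchoose _ hZ
          refine ⟨x, hx, hxS, ?_, ?_, by tauto⟩
          · rcases hxZ with hxZ | hxZ
            · exact Or.inl fun hh => hxZ (Finset.mem_union_left _ hh)
            · exact Or.inr (Or.inr (hxZ.trans hmonoA))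
          · rcases hxZ with hxZ | hxZ
            · exact Or.inl fun hh => hxZ (Finset.mem_union_right _ hh)
            · exact Or.inr (Or.inr (hxZ.trans hmonoB))
    refine ih (insert y S) (Function.update f y x) ?_ ?_ (Finset.mem_insert_of_mem huS)
      (Finset.mem_insert_of_mem hvS) ?_ ?_ ?_ (h1.insert_update hyS hxA) (h2.insert_update hyS hxB)
      (h3.insert_update hyS hxAB)
    · exact Finset.insert_subset hyR hSR
    · rw [Finset.sdiff_insert, Finset.card_erase_of_mem hy, hn]; rfl
    · rw [Function.update_of_ne (by rintro rfl; exact hyS huS), hfu]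
    · rw [Function.update_of_ne (by rintro rfl; exact hyS hvS), hfv]
    · exact hf.insert_update hyS hpy (fun z hz hzr he => hyS (he ▸ hf.par_mem z hz hzr)) hx hxS

end Skeleton

section RootedEmbedding

variable {V W : Type*} [DecidableEq V] [DecidableEq W]
  {Nb : Bool → V → Finset V} {t m : ℕ} {side : W → Bool} {r : W} {par : W → W}
  {G : SimpleGraph W} {depth : W → ℕ}

/-- An ancestor-closed set containing the root `r` and the vertex `e` can be embedded, with `r`
sent to a prescribed vertex, so that the image is spread out with respect to the neighbourhoods
of the images of `r` and `e`. -/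
theorem IsRooted.exists_partialEmb [DecidableRel G.Adj] (hrt : IsRooted G r par depth)
    (hN : SparseNbr Nb t m) {h : ℕ} (hm : 3 * t + h + 2 ≤ m)
    (hside : ∀ y, y ≠ r → side y = !side (par y)) {R : Finset W}
    (hR : ∀ y ∈ R, y ≠ r → par y ∈ R) (hRcard : R.card ≤ m + 1)
    {e : W} (her : e ≠ r) (heR : e ∈ R) (hdep : depth e ≤ 2 * h + 2)
    {c : V} (hc : (Nb (side r) c).Nonempty) :
    ∃ f : W → V, f r = c ∧ PartialEmb Nb side r par R f ∧
      Spread (Nb (side r) (f r)) (fun y => if G.Adj r y then 1 else 0) 0 (m - 2 * t) R f ∧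
      Spread (Nb (side e) (f e)) (fun y => if G.Adj e y then 1 else 0) h (m - 2 * t) R f ∧
      Spread (Nb (side r) (f r) ∪ Nb (side e) (f e))
        (fun y => (if G.Adj r y then 1 else 0) + (if G.Adj e y then 1 else 0)) h
        (m - 2 * t) R f := by
  set σ : ℕ → Bool := fun j => xor (side r) (Nat.bodd j) with hσdef
  have hσ : ∀ j, σ (j + 1) = !σ j := by intro j; simp [hσdef]
  have hσ0 : σ 0 = side r := by simp [hσdef]
  have hsd : ∀ n y, depth y = n → side y = σ n := by
    intro n
    induction n with
    | zero => intro y hy; rw [hrt.eq_root_of_depth hy, hσ0]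
    | succ n ih =>
      intro y hy
      have hyr : y ≠ r := by rintro rfl; rw [hrt.depth_root] at hy; omega
      rw [hside y hyr, ih (par y) (by have := hrt.depth_par y hyr; omega), hσ]
  set p := depth e with hp
  have hp1 : 1 ≤ p := by
    by_contra hlt
    exact her (hrt.eq_root_of_depth (by omega))
  obtain ⟨g, hg0, hginj, hgadj, hgc, hgp⟩ :=
    hN.exists_spread_path hm σ hσ c (by rwa [hσ0]) p hdep
  set S : Finset W := (Finset.range (p + 1)).image (fun i => par^[i] e) with hS
  set f : W → V := fun y => g (depth y) with hf
  have hdi := hrt.depth_iterate e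
  rw [← hp] at hdi
  have hitr : par^[p] e = r := hrt.eq_root_of_depth (by rw [hdi p le_rfl]; omega)
  have hmemS : ∀ i ≤ p, par^[i] e ∈ S := fun i hi =>
    Finset.mem_image.2 ⟨i, Finset.mem_range.2 (by omega), rfl⟩
  have hSdep : ∀ y ∈ S, ∃ i ≤ p, par^[i] e = y ∧ depth y = p - i := by
    intro y hy
    obtain ⟨i, hi, rfl⟩ := Finset.mem_image.1 hy
    have hi' : i ≤ p := by have := Finset.mem_range.1 hi; omega
    exact ⟨i, hi', rfl, hdi i hi'⟩
  have hrS : r ∈ S := hitr ▸ hmemS p le_rfl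
  have heS : e ∈ S := hmemS 0 (by omega)
  have hparS : ∀ y ∈ S, y ≠ r → par y ∈ S := by
    intro y hy hyr
    obtain ⟨i, hi, rfl, -⟩ := hSdep y hy
    have hip : i ≠ p := by rintro rfl; exact hyr hitr
    rw [← Function.iterate_succ_apply' par i e]
    exact hmemS (i + 1) (by omega)
  have hSR : S ⊆ R := by
    have key : ∀ i ≤ p, par^[i] e ∈ R := by
      intro i
      induction i with
      | zero => intro _; exact heR
      | succ i ih =>
        intro hi
        rw [Function.iterate_succ_apply']
        refine hR _ (ih (by omega)) ?_
        intro h0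
        have := hdi i (by omega)
        rw [h0, hrt.depth_root] at this
        omega
    intro y hy
    obtain ⟨i, hi, rfl, -⟩ := hSdep y hy
    exact key i hi
  have himg : S.image f = (Finset.range (p + 1)).image g := by
    ext x
    simp only [Finset.mem_image, Finset.mem_range]
    constructor
    · rintro ⟨y, hy, rfl⟩
      obtain ⟨i, hi, -, hd⟩ := hSdep y hy
      exact ⟨depth y, by omega, rfl⟩
    · rintro ⟨j, hj, rfl⟩
      refine ⟨par^[p - j] e, hmemS _ (by omega), ?_⟩
      simp only [hf]
      rw [hdi _ (by omega)]
      congr 1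
      omega
  have hfr : f r = c := by simp only [hf]; rw [hrt.depth_root, hg0]
  have hPE : PartialEmb Nb side r par S f := by
    refine ⟨hrS, by rwa [hfr], hparS, ?_, ?_⟩
    · intro y hy z hz hyz
      obtain ⟨i, hi, rfl, hd⟩ := hSdep y hy
      obtain ⟨j, hj, rfl, hd'⟩ := hSdep z hz
      have := hginj _ _ (by omega) (by omega) hyz
      rw [hd, hd'] at this
      rw [show i = j by omega]
    · intro y hy hyr
      obtain ⟨i, hi, -, hd⟩ := hSdep y hy
      have hdp := hrt.depth_par y hyr
      simp only [hf]
      rw [hdp, hsd _ (par y) rfl]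
      exact hgadj _ (by omega)
  have hAsub : S.image f ∩ Nb (side r) c ⊆ {g 1} := by
    intro x hx
    rw [himg, Finset.mem_inter, Finset.mem_image] at hx
    obtain ⟨⟨j, hj, rfl⟩, hxN⟩ := hx
    rw [Finset.mem_range] at hj
    rcases Nat.lt_or_ge j 2 with hj2 | hj2
    · interval_cases j
      · rw [hg0] at hxN
        exact absurd hxN (hN.irrefl _ _)
      · simp
    · exact absurd hxN (by rw [← hσ0]; exact hgc j hj2 (by omega))
  have hBsub : S.image f ∩ Nb (side e) (f e) ⊆
      Nb (σ p) (g p) ∩ (Finset.range p).image g := by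
    have hfe : Nb (side e) (f e) = Nb (σ p) (g p) := by rw [hsd p e rfl]
    rw [hfe]
    intro x hx
    rw [himg, Finset.mem_inter, Finset.mem_image] at hx
    obtain ⟨⟨j, hj, rfl⟩, hxN⟩ := hx
    refine Finset.mem_inter.2 ⟨hxN, Finset.mem_image.2 ⟨j, ?_, rfl⟩⟩
    rw [Finset.mem_range] at hj ⊢
    have : j ≠ p := by rintro rfl; exact hN.irrefl _ _ hxN
    omega
  have hA := Finset.card_le_card hAsub
  have hB := Finset.card_le_card hBsub
  rw [Finset.card_singleton] at hA
  have hwr : 1 ≤ ∑ y ∈ S, (if G.Adj r y then 1 else 0) := by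
    have hmem := hmemS (p - 1) (by omega)
    have hd := hdi (p - 1) (by omega)
    have hne : par^[p - 1] e ≠ r := by
      intro h0
      rw [h0, hrt.depth_root] at hd
      omega
    have hadj := hrt.adj_par _ hne
    rw [← Function.iterate_succ_apply' par, show (p - 1).succ = p by omega, hitr] at hadj
    calc 1 = if G.Adj r (par^[p - 1] e) then 1 else 0 := by rw [if_pos hadj.symm]
      _ ≤ _ := Finset.single_le_sum (f := fun y => if G.Adj r y then 1 else 0)
        (fun _ _ => Nat.zero_le _) hmem
  have hwe : 1 ≤ ∑ y ∈ S, (if G.Adj e y then 1 else 0) := by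
    calc 1 = if G.Adj e (par e) then 1 else 0 := by rw [if_pos (hrt.adj_par e her)]
      _ ≤ _ := Finset.single_le_sum (f := fun y => if G.Adj e y then 1 else 0)
        (fun _ _ => Nat.zero_le _) (hparS e heS her)
  have hone : ∀ u y, y ≠ r → par y = u → 1 ≤ if G.Adj u y then 1 else 0 := by
    rintro _ y hyr rfl
    rw [if_pos (hrt.adj_par y hyr).symm]
  obtain ⟨f', hf'r, hf'e, h1, h2, h3, h4⟩ := PartialEmb.extend hN hrt.depth_par hside hR hRcard
    (u := r) (v := e) (wu := fun y => if G.Adj r y then 1 else 0)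
    (wv := fun y => if G.Adj e y then 1 else 0) (hone r) (hone e) (a := c) (b := f e)
    (hu := 0) (hv := h) (h := h) _ S f hSR rfl hrS heS hfr rfl hPE
    (Or.inl (by dsimp only; omega)) (Or.inl (by dsimp only; omega)) (Or.inl (by
      rw [Finset.inter_union_distrib_left, Finset.sum_add_distrib]
      have := Finset.card_union_le (S.image f ∩ Nb (side r) c) (S.image f ∩ Nb (side e) (f e))
      omega))
  rw [← hf'r] at h2 h4
  rw [← hf'e] at h3 h4
  exact ⟨f', hf'r, h1, h2, h3, h4⟩

end RootedEmbedding

section Hall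

variable {V W : Type*} [DecidableEq V] [DecidableEq W]

set_option maxHeartbeats 1000000 in
/-- Hall's condition for attaching, to each vertex `y` of `R`, `ℓ y` pendant vertices chosen
in `N y \ U`. -/
theorem sum_le_card_biUnion_sdiff {R : Finset W} {N : W → Finset V} {U : Finset V}
    {ℓ d d' : W → ℕ} {k t m h : ℕ} {u v : W} (hu : u ∈ R) (hv : v ∈ R) (huv : u ≠ v)
    (hcodeg : ∀ x ∈ R, ∀ y ∈ R, x ≠ y → (N x ∩ N y).card ≤ t)
    (hmin : ∀ y ∈ R, m ≤ (N y).card)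
    (hmiss : ∀ y ∈ R, (N y ∩ U).card + 1 ≤ U.card)
    (hsum : ∑ y ∈ R, ℓ y + U.card = k + 1)
    (hd : ∀ y ∈ R, ℓ y + d' y = d y) (hd' : ∀ y ∈ R, 1 ≤ d' y)
    (hU : d' u ≤ (U ∩ N u).card)
    (hL2 : d u + d v ≤ ∑ y ∈ R, ℓ y + 2)
    (hL3 : ∀ y ∈ R, y ≠ u → y ≠ v → d u + d v + d y ≤ ∑ y ∈ R, ℓ y + 4)
    (hSu : (U ∩ N u).card ≤ d' u + h ∨ m - 2 * t ≤ (U \ N u).card)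
    (hSv : (U ∩ N v).card ≤ d' v + h ∨ m - 2 * t ≤ (U \ N v).card)
    (hSuv : (U ∩ (N u ∪ N v)).card ≤ d' u + d' v + h ∨ m - 2 * t ≤ (U \ (N u ∪ N v)).card)
    (hm : 3 * t + h + 2 ≤ m) (hm2 : k + 2 + 3 * t ≤ 2 * m + d u) (hm3 : k + 3 ≤ m + d u + d v)
    (hdv : 3 * t + 2 ≤ d v) (hau : d u + h ≤ (N u).card) (hau' : k + 1 ≤ (N u).card + m)
    (hbv : d v + h ≤ (N v).card) (hab : d u + d v + h + t ≤ (N u).card + (N v).card)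
    (hab' : k + 1 ≤ (N u).card + (N v).card) {X : Finset W} (hXR : X ⊆ R) (hX : X.Nonempty) :
    ∑ y ∈ X, ℓ y ≤ (X.biUnion N \ U).card := by
  set L := ∑ y ∈ R, ℓ y with hL
  have hXL : ∑ y ∈ X, ℓ y ≤ L := Finset.sum_le_sum_of_subset hXR
  have hcard : ∀ A : Finset V, (A \ U).card + (U ∩ A).card = A.card := fun A => by
    rw [Finset.inter_comm]; exact Finset.card_sdiff_add_card_inter A U
  have hcardU : ∀ A : Finset V, (U \ A).card + (U ∩ A).card = U.card := fun A =>
    Finset.card_sdiff_add_card_inter U A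
  have hunion : ∀ A B : Finset V, (A ∪ B).card + (A ∩ B).card = A.card + B.card :=
    Finset.card_union_add_card_inter
  have hmono : ∀ A : Finset V, A ⊆ X.biUnion N → (A \ U).card ≤ (X.biUnion N \ U).card :=
    fun A hA => Finset.card_le_card (Finset.sdiff_subset_sdiff hA le_rfl)
  have hsub : ∀ y ∈ X, N y ⊆ X.biUnion N := fun y hy => Finset.subset_biUnion_of_mem N hy
  have hdu := hd u hu
  have hdv' := hd v hv
  have hd'u := hd' u hu
  have hd'v := hd' v hv
  have hcuv := hcodeg u hu v hv huv
  have hmv := hmin v hv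
  by_cases huX : u ∈ X
  · by_cases hone : X = {u}
    · subst hone
      rw [Finset.sum_singleton, Finset.singleton_biUnion]
      have h1 := hcard (N u)
      have h2 := hcardU (N u)
      omega
    · obtain ⟨y, hy⟩ : (X.erase u).Nonempty := by
        rw [Finset.nonempty_iff_ne_empty, Ne, Finset.erase_eq_empty_iff]
        rintro (h | h)
        · exact hX.ne_empty h
        · exact hone h
      obtain ⟨hyu, hyX⟩ := Finset.mem_erase.1 hy
      by_cases htwo : X = {u, y}
      · subst htwo
        clear hSu hSv
        rw [Finset.sum_pair hyu.symm, Finset.biUnion_insert, Finset.singleton_biUnion]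
        have h1 := hcard (N u ∪ N y)
        have h2 := hcardU (N u ∪ N y)
        have h3 := hunion (N u) (N y)
        have h4 := hcodeg u hu y (hXR hyX) hyu.symm
        have h5 := hmin y (hXR hyX)
        have h6 := hd y (hXR hyX)
        have h7 := hd' y (hXR hyX)
        by_cases hyv : y = v
        · subst hyv
          omega
        · have h8 := hL3 y (hXR hyX) hyu hyv
          clear hSuv
          omega
      · obtain ⟨z, hz⟩ : ((X.erase u).erase y).Nonempty := by
          rw [Finset.nonempty_iff_ne_empty, Ne, Finset.erase_eq_empty_iff]
          rintro (h | h)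
          · exact absurd hy (h ▸ Finset.notMem_empty y)
          · apply htwo
            rw [← Finset.insert_erase huX, h]
        simp only [Finset.mem_erase] at hz
        obtain ⟨hzy, hzu, hzX⟩ := hz
        have h0 := hmono (N u ∪ (N y ∪ N z))
          (Finset.union_subset (hsub u huX) (Finset.union_subset (hsub y hyX) (hsub z hzX)))
        have h1 := hcard (N u ∪ (N y ∪ N z))
        have h2 := hcardU (N u ∪ (N y ∪ N z))
        have h3 := hunion (N u) (N y ∪ N z)
        have h4 := hunion (N y) (N z)
        have h5 := hcodeg y (hXR hyX) z (hXR hzX) hzy.symm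
        have h6 := hcodeg u hu y (hXR hyX) hyu.symm
        have h7 := hcodeg u hu z (hXR hzX) hzu.symm
        have h8 := Finset.card_union_le (N u ∩ N y) (N u ∩ N z)
        rw [← Finset.inter_union_distrib_left] at h8
        have h9 := hmin y (hXR hyX)
        have h10 := hmin z (hXR hzX)
        clear hSu hSv hSuv
        omega
  · obtain ⟨y, hy⟩ := hX
    have hyu : y ≠ u := by rintro rfl; exact huX hy
    by_cases hone : X = {y}
    · subst hone
      rw [Finset.sum_singleton, Finset.singleton_biUnion]
      have h1 := hcard (N y)
      have h2 := hcardU (N y)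
      have h3 := hmin y (hXR hy)
      by_cases hyv : y = v
      · subst hyv
        omega
      · have h4 := hL3 y (hXR hy) hyu hyv
        have h5 := hmiss y (hXR hy)
        rw [Finset.inter_comm] at h5
        have h6 := hd y (hXR hy)
        have h7 := hd' y (hXR hy)
        clear hSu hSv hSuv
        omega
    · obtain ⟨z, hz⟩ : (X.erase y).Nonempty := by
        rw [Finset.nonempty_iff_ne_empty, Ne, Finset.erase_eq_empty_iff]
        rintro (h | h)
        · exact absurd hy (h ▸ Finset.notMem_empty y)
        · exact hone h
      obtain ⟨hzy, hzX⟩ := Finset.mem_erase.1 hz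
      have hzu : z ≠ u := by rintro rfl; exact huX hzX
      have h0 := hmono (N y ∪ N z) (Finset.union_subset (hsub y hy) (hsub z hzX))
      have h1 := hcard (N y ∪ N z)
      have h2 := hunion (N y) (N z)
      have h3 := hcodeg y (hXR hy) z (hXR hzX) hzy.symm
      have h4 := hcodeg u hu y (hXR hy) hyu.symm
      have h5 := hcodeg u hu z (hXR hzX) hzu.symm
      have h6 := hmin y (hXR hy)
      have h7 := hmin z (hXR hzX)
      have h8 := Finset.card_union_le (N u ∩ N y) (N u ∩ N z)
      have h9 : (U ∩ (N y ∪ N z)).card ≤ (U \ N u).card + (N u ∩ N y ∪ N u ∩ N z).card := by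
        refine (Finset.card_le_card ?_).trans (Finset.card_union_le _ _)
        intro x hx
        simp only [Finset.mem_union, Finset.mem_inter, Finset.mem_sdiff] at hx ⊢
        tauto
      have h10 := hcardU (N u)
      have h11 : ℓ u + ∑ y ∈ X, ℓ y ≤ L := by
        rw [← Finset.sum_insert huX]
        exact Finset.sum_le_sum_of_subset (Finset.insert_subset hu hXR)
      clear hSu hSv hSuv
      omega

end Hall

section Leaves

variable {V W : Type*} [DecidableEq V] [Fintype W] [DecidableEq W]
  {G : SimpleGraph W} [DecidableRel G.Adj] {Nb : Bool → V → Finset V} {t m : ℕ}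
  {side : W → Bool} {r : W} {par : W → W} {depth : W → ℕ}

/-- An embedding of the non-leaves of a tree that is spread out with respect to the
neighbourhoods of the images of `u` and `v` extends to the leaves. -/
theorem PartialEmb.exists_injective (hG : G.IsTree) (hrt : IsRooted G r par depth)
    (hr : 2 ≤ G.degree r) (hN : SparseNbr Nb t m)
    (hside : ∀ y, y ≠ r → side y = !side (par y)) {k h : ℕ} (hW : Fintype.card W = k + 1)
    {f : W → V} (hf : PartialEmb Nb side r par (univ.filter fun y => 2 ≤ G.degree y) f)
    {u v : W} (huv : u ≠ v)
    (hSu : Spread (Nb (side u) (f u)) (fun y => if G.Adj u y then 1 else 0) h (m - 2 * t)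
      (univ.filter fun y => 2 ≤ G.degree y) f)
    (hSv : Spread (Nb (side v) (f v)) (fun y => if G.Adj v y then 1 else 0) h (m - 2 * t)
      (univ.filter fun y => 2 ≤ G.degree y) f)
    (hSuv : Spread (Nb (side u) (f u) ∪ Nb (side v) (f v))
      (fun y => (if G.Adj u y then 1 else 0) + (if G.Adj v y then 1 else 0)) h (m - 2 * t)
      (univ.filter fun y => 2 ≤ G.degree y) f)
    (hm : 3 * t + h + 2 ≤ m) (hm2 : k + 2 + 3 * t ≤ 2 * m + G.degree u)
    (hm3 : k + 3 ≤ m + G.degree u + G.degree v)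
    (hdu : 2 ≤ G.degree u) (hdv : 3 * t + 2 ≤ G.degree v)
    (hau : G.degree u + h ≤ (Nb (side u) (f u)).card)
    (hau' : k + 1 ≤ (Nb (side u) (f u)).card + m)
    (hbv : G.degree v + h ≤ (Nb (side v) (f v)).card)
    (hab : G.degree u + G.degree v + h + t ≤
      (Nb (side u) (f u)).card + (Nb (side v) (f v)).card)
    (hab' : k + 1 ≤ (Nb (side u) (f u)).card + (Nb (side v) (f v)).card) :
    ∃ F : W → V, Function.Injective F ∧
      ∀ y, y ≠ r → F y ∈ Nb (side (par y)) (F (par y)) := by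
  set R : Finset W := univ.filter fun y => 2 ≤ G.degree y with hRdef
  have hmemR : ∀ y, y ∈ R ↔ 2 ≤ G.degree y := by intro y; simp [hRdef]
  have hparR : ∀ y, y ≠ r → par y ∈ R := fun y hy =>
    (hmemR _).2 (hrt.two_le_degree_par hr hy)
  have huR : u ∈ R := (hmemR u).2 hdu
  have hvR : v ∈ R := (hmemR v).2 (by omega)
  have hrR : r ∈ R := (hmemR r).2 hr
  set N : W → Finset V := fun y => Nb (side y) (f y) with hNdef
  set U : Finset V := R.image f with hUdef
  set ℓ : W → ℕ := fun y => (univ.filter fun z => z ∉ R ∧ par z = y).card with hℓ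
  have hUcard : U.card = R.card := Finset.card_image_of_injOn hf.injOn
  have hL : ∑ y ∈ R, ℓ y = (univ.filter fun z => ¬ 2 ≤ G.degree z).card := by
    rw [Finset.card_eq_sum_card_fiberwise (f := par) (t := R)]
    · refine Finset.sum_congr rfl fun y _ => ?_
      rw [Finset.filter_filter]
      simp only [hℓ, hmemR]
    · intro z hz
      refine hparR z ?_
      rintro rfl
      simp only [Finset.coe_filter, Finset.mem_univ, true_and, Set.mem_ofPred_eq] at hz
      exact hz hr
  have hLR : ∑ y ∈ R, ℓ y + R.card = k + 1 := by
    rw [hL, ← hW, add_comm, hRdef, Finset.card_filter_add_card_filter_not, Finset.card_univ]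
  have hd' : ∀ y, ∑ z ∈ R, (if G.Adj y z then 1 else 0) = (R.filter (G.Adj y)).card := fun y =>
    (Finset.card_filter _ _).symm
  have hdeg : ∀ y ∈ R, ℓ y + (R.filter (G.Adj y)).card = G.degree y := by
    intro y hy
    rw [← G.card_neighborFinset_eq_degree, hℓ, ← Finset.card_union_of_disjoint]
    · congr 1
      ext z
      simp only [Finset.mem_union, Finset.mem_filter, Finset.mem_univ, true_and,
        SimpleGraph.mem_neighborFinset]
      constructor
      · rintro (⟨hz, rfl⟩ | ⟨-, hz⟩)
        · exact (hrt.adj_par z (by rintro rfl; exact hz hrR)).symm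
        · exact hz
      · intro hz
        by_cases hzR : z ∈ R
        · exact Or.inr ⟨hzR, hz⟩
        · rcases hrt.of_adj y z hz with ⟨hyr, rfl⟩ | ⟨_, rfl⟩
          · exact absurd (hparR y hyr) hzR
          · exact Or.inl ⟨hzR, rfl⟩
    · rw [Finset.disjoint_left]
      intro z hz hz'
      exact (Finset.mem_filter.1 hz).2.1 (Finset.mem_filter.1 hz').1
  have hpos : ∀ y ∈ R, 1 ≤ (R.filter (G.Adj y)).card := by
    intro y hy
    apply Finset.card_pos.2
    by_cases hyr : y = r
    · subst hyr
      obtain ⟨x, hx, hxy⟩ : ∃ x ∈ R, x ≠ y := by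
        by_cases huy : u = y
        · exact ⟨v, hvR, fun hvy => huv (huy.trans hvy.symm)⟩
        · exact ⟨u, huR, huy⟩
      obtain ⟨z, hz, hzy, hp⟩ := hrt.exists_par_eq_root hf.par_mem _ x hx hxy rfl
      refine ⟨z, Finset.mem_filter.2 ⟨hz, ?_⟩⟩
      have := (hrt.adj_par z hzy).symm
      rwa [hp] at this
    · exact ⟨par y, Finset.mem_filter.2 ⟨hparR y hyr, hrt.adj_par y hyr⟩⟩
  have hUu : (R.filter (G.Adj u)).card ≤ (U ∩ N u).card := by
    rw [← Finset.card_image_of_injOn (hf.injOn.mono (Finset.coe_subset.2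
      (Finset.filter_subset (G.Adj u) R)))]
    apply Finset.card_le_card
    intro x hx
    obtain ⟨z, hz, rfl⟩ := Finset.mem_image.1 hx
    obtain ⟨hzR, hz⟩ := Finset.mem_filter.1 hz
    refine Finset.mem_inter.2 ⟨Finset.mem_image_of_mem f hzR, ?_⟩
    rcases hrt.of_adj u z hz with ⟨hur, rfl⟩ | ⟨hzr, rfl⟩
    · have := hN.symm _ _ _ (hf.adj u huR hur)
      rwa [← hside u hur] at this
    · exact hf.adj z hzR hzr
  have hW2 : 2 ≤ Fintype.card W := Fintype.one_lt_card_iff.2 ⟨u, v, huv⟩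
  have hL2 := two_mul_add_sum_degree_le hG hW2 {u, v} (by
    intro x hx
    rcases Finset.mem_insert.1 hx with rfl | hx
    · exact hdu
    · rw [Finset.mem_singleton.1 hx]; omega)
  rw [Finset.sum_pair huv, Finset.card_pair huv, ← hL] at hL2
  have hL3 : ∀ y ∈ R, y ≠ u → y ≠ v →
      G.degree u + G.degree v + G.degree y ≤ ∑ y ∈ R, ℓ y + 4 := by
    intro y hy hyu hyv
    have hnot : y ∉ ({u, v} : Finset W) := by simp [hyu, hyv]
    have := two_mul_add_sum_degree_le hG hW2 (insert y {u, v}) (by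
      intro x hx
      rcases Finset.mem_insert.1 hx with rfl | hx
      · exact (hmemR _).1 hy
      · rcases Finset.mem_insert.1 hx with rfl | hx
        · exact hdu
        · rw [Finset.mem_singleton.1 hx]; omega)
    rw [Finset.sum_insert hnot, Finset.card_insert_of_notMem hnot, Finset.sum_pair huv,
      Finset.card_pair huv, ← hL] at this
    omega
  unfold Spread at hSu hSv hSuv
  rw [Finset.sum_add_distrib] at hSuv
  rw [hd'] at hSu hSv hSuv
  rw [hd'] at hSuv
  have hall : ∀ X ⊆ R, X.Nonempty → ∑ y ∈ X, ℓ y ≤ (X.biUnion N \ U).card := fun X hXR hX =>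
    sum_le_card_biUnion_sdiff (d := fun y => G.degree y) (d' := fun y => (R.filter (G.Adj y)).card)
      huR hvR huv
      (fun x hx y hy hxy => hN.codeg _ _ _ _ fun he => hxy (hf.injOn hx hy he))
      (fun y hy => hN.min_le _ _ (hf.nonempty hN hside hy))
      (fun y hy => by
        rw [← Finset.card_erase_add_one (Finset.mem_image_of_mem f hy), Nat.add_le_add_iff_right]
        apply Finset.card_le_card
        intro x hx
        obtain ⟨hx, hxU⟩ := Finset.mem_inter.1 hx
        exact Finset.mem_erase.2 ⟨by rintro rfl; exact hN.irrefl _ _ hx, hxU⟩)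
      (by rw [hUcard]; exact hLR) hdeg hpos hUu (by omega) hL3 hSu hSv hSuv hm hm2 hm3
      hdv hau hau' hbv hab hab' hXR hX
  obtain ⟨g, hginj, hg⟩ := (Finset.all_card_le_biUnion_card_iff_exists_injective
    (fun y : {y // y ∉ R} => N (par y) \ U)).1 (by
      intro s
      rcases s.eq_empty_or_nonempty with rfl | hs
      · simp
      · have hX := hall (s.image fun y : {y // y ∉ R} => par y) (by
          intro y hy
          obtain ⟨z, -, rfl⟩ := Finset.mem_image.1 hy
          exact hparR _ (by rintro h; exact z.2 (h ▸ hrR))) (hs.image _)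
        refine le_trans ?_ (hX.trans (Finset.card_le_card ?_))
        · rw [Finset.card_eq_sum_card_image (fun y : {y // y ∉ R} => par y) s]
          refine Finset.sum_le_sum fun y _ => ?_
          refine Finset.card_le_card_of_injOn Subtype.val ?_ Subtype.val_injective.injOn
          intro z hz
          have hz' := (Finset.mem_filter.1 hz).2
          simpa using ⟨z.2, hz'⟩
        · intro x hx
          simp only [Finset.mem_sdiff, Finset.mem_biUnion, Finset.mem_image] at hx ⊢
          obtain ⟨⟨_, ⟨z, hz, rfl⟩, hxz⟩, hxU⟩ := hx
          exact ⟨z, hz, hxz, hxU⟩)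
  refine ⟨fun y => if hy : y ∈ R then f y else g ⟨y, hy⟩, ?_, ?_⟩
  · intro x y hxy
    have hgU : ∀ z, g z ∉ U := fun z => (Finset.mem_sdiff.1 (hg z)).2
    dsimp only at hxy
    split_ifs at hxy with hx hy hy
    · exact hf.injOn hx hy hxy
    · exact absurd (hxy ▸ Finset.mem_image_of_mem f hx) (hgU _)
    · exact absurd (hxy ▸ Finset.mem_image_of_mem f hy) (hgU _)
    · exact congrArg Subtype.val (hginj hxy)
  · intro y hy
    dsimp only
    rw [dif_pos (hparR y hy)]
    split_ifs with hyR
    · exact hf.adj y hyR hy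
    · exact (Finset.mem_sdiff.1 (hg ⟨y, hyR⟩)).1

end Leaves

section Peeling

variable {V : Type*} [Fintype V]

theorem sum_card_outNbr (A : V → V → Bool) : ∑ x, (outNbr A x).card = arcCount A := by
  classical
  rw [arcCount, Finset.card_eq_sum_card_fiberwise (f := Prod.fst) (t := univ) (fun _ _ => by simp)]
  refine Finset.sum_congr rfl fun x _ => ?_
  refine Finset.card_nbij' (fun w => (x, w)) Prod.snd ?_ ?_ ?_ ?_
  · intro w hw; simpa [outNbr] using hw
  · rintro ⟨a, b⟩ hw
    simp only [Finset.coe_filter, Finset.mem_filter, Finset.mem_univ, true_and,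
      Set.mem_ofPred_eq] at hw
    obtain ⟨hw, rfl⟩ := hw
    simpa [outNbr] using hw
  · intro w _; rfl
  · rintro ⟨a, b⟩ hw
    simp only [Finset.coe_filter, Finset.mem_filter, Finset.mem_univ, true_and,
      Set.mem_ofPred_eq] at hw
    rw [← hw.2]

theorem sum_card_inNbr (A : V → V → Bool) : ∑ x, (inNbr A x).card = arcCount A := by
  have h := sum_card_outNbr fun x y => A y x
  rw [arcCount] at h ⊢
  refine h.trans (Finset.card_nbij' Prod.swap Prod.swap ?_ ?_ (fun _ _ => rfl) fun _ _ => rfl) <;>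
    rintro ⟨a, b⟩ hab <;> simpa using hab

variable [DecidableEq V]

/-- A digraph with more than `(x + y) |V|` arcs has a bipartite subdigraph with parts `A`, `B`,
all arcs directed from `A` to `B`, with more than `x |A| + y |B|` arcs, all out-degrees in `A`
exceeding `x` and all in-degrees in `B` exceeding `y`. -/
theorem exists_bipartite_subdigraph (D : V → V → Bool) {x y : ℕ}
    (hD : (x + y) * Fintype.card V < arcCount D) :
    ∃ (D' : V → V → Bool) (A B : Finset V), (∀ a b, D' a b → D a b ∧ a ∈ A ∧ b ∈ B) ∧
      x * A.card + y * B.card < arcCount D' ∧ (∀ a ∈ A, x < (outNbr D' a).card) ∧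
      ∀ b ∈ B, y < (inNbr D' b).card := by
  set E : Finset V → Finset V → V → V → Bool :=
    fun A B a b => decide (a ∈ A ∧ b ∈ B ∧ D a b) with hE
  have hEsub : ∀ A B a b, E A B a b → D a b ∧ a ∈ A ∧ b ∈ B := by
    intro A B a b h
    simp only [hE, decide_eq_true_eq] at h
    exact ⟨h.2.2, h.1, h.2.1⟩
  have hex : ∃ n, ∃ A B : Finset V, A.card + B.card = n ∧
      x * A.card + y * B.card < arcCount (E A B) := by
    refine ⟨_, univ, univ, rfl, ?_⟩
    rw [Finset.card_univ, ← add_mul]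
    simpa [hE] using hD
  obtain ⟨A, B, hn, hAB⟩ := Nat.find_spec hex
  have hmin : ∀ A' B' : Finset V, A'.card + B'.card < A.card + B.card →
      arcCount (E A' B') ≤ x * A'.card + y * B'.card := by
    intro A' B' hlt
    by_contra! hcon
    exact Nat.find_min hex (hn ▸ hlt) ⟨A', B', rfl, hcon⟩
  refine ⟨E A B, A, B, hEsub A B, hAB, ?_, ?_⟩
  · intro a ha
    by_contra! hle
    have hca := Finset.card_erase_add_one ha
    have hm := hmin (A.erase a) B (by omega)
    have hcount : arcCount (E A B) ≤ arcCount (E (A.erase a) B) + (outNbr (E A B) a).card := by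
      rw [← sum_card_outNbr, ← sum_card_outNbr, ← Finset.add_sum_erase univ _ (Finset.mem_univ a),
        add_comm]
      gcongr
      rw [← Finset.add_sum_erase univ (fun z => (outNbr (E (A.erase a) B) z).card)
        (Finset.mem_univ a)]
      refine le_trans (Finset.sum_le_sum fun z hz => ?_) (Nat.le_add_left _ _)
      have hza := Finset.ne_of_mem_erase hz
      refine Finset.card_le_card fun w hw => ?_
      simpa [hE, outNbr, hza] using hw
    rw [← hca] at hAB
    nlinarith
  · intro b hb
    by_contra! hle
    have hcb := Finset.card_erase_add_one hb
    have hm := hmin A (B.erase b) (by omega)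
    have hcount : arcCount (E A B) ≤ arcCount (E A (B.erase b)) + (inNbr (E A B) b).card := by
      rw [← sum_card_inNbr, ← sum_card_inNbr, ← Finset.add_sum_erase univ _ (Finset.mem_univ b),
        add_comm]
      gcongr
      rw [← Finset.add_sum_erase univ (fun z => (inNbr (E A (B.erase b)) z).card)
        (Finset.mem_univ b)]
      refine le_trans (Finset.sum_le_sum fun z hz => ?_) (Nat.le_add_left _ _)
      have hzb := Finset.ne_of_mem_erase hz
      refine Finset.card_le_card fun w hw => ?_
      simpa [hE, inNbr, hzb] using hw
    rw [← hcb] at hAB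
    nlinarith

/-- In a digraph without `t + 1` common neighbours of any two vertices, there are signed
neighbourhoods with prescribed minimum sizes `δ s`, some of them of size at least `δ s + t`. -/
theorem exists_sparseNbr (D : V → V → Bool) (hloop : Loopless D) {t : ℕ}
    (hfree : K2sFree D (t + 1)) {δ : Bool → ℕ} (hδ : ∀ s, t + 1 ≤ δ s)
    (hD : (δ true + δ false - 2) * Fintype.card V < arcCount D) :
    ∃ Nb : Bool → V → Finset V, (∀ a b, b ∈ Nb true a → D a b) ∧
      (∀ m, (∀ s, m ≤ δ s) → SparseNbr Nb t m) ∧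
      (∀ s a, (Nb s a).Nonempty → δ s ≤ (Nb s a).card) ∧
      (∀ s, ∃ a, (Nb s a).Nonempty) ∧ ∃ s a, δ s + t ≤ (Nb s a).card := by
  have hδt := hδ true
  have hδf := hδ false
  obtain ⟨D', A, B, hsub, hcount, hA, hB⟩ :=
    exists_bipartite_subdigraph D (x := δ true - 1) (y := δ false - 1)
      (by rwa [show δ true - 1 + (δ false - 1) = δ true + δ false - 2 by omega])
  have hmemt : ∀ a b, b ∈ nbr D' true a ↔ D' a b := by intro a b; simp [nbr, outNbr]
  have hmemf : ∀ a b, b ∈ nbr D' false a ↔ D' b a := by intro a b; simp [nbr, inNbr]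
  have hnbr : ∀ s a, nbr D' s a ⊆ nbr D s a := by
    intro s a b hb
    cases s
    · rw [hmemf] at hb
      simpa [nbr, inNbr] using (hsub _ _ hb).1
    · rw [hmemt] at hb
      simpa [nbr, outNbr] using (hsub _ _ hb).1
  have hirr : ∀ s a, a ∉ nbr D s a := by
    intro s a
    cases s <;> simpa [nbr, outNbr, inNbr] using hloop a
  have hlow : ∀ s a, (nbr D' s a).Nonempty → δ s ≤ (nbr D' s a).card := by
    rintro s a ⟨b, hb⟩
    cases s
    · rw [hmemf] at hb
      have := hB a (hsub _ _ hb).2.2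
      simp only [nbr, Bool.false_eq_true, if_false]
      omega
    · rw [hmemt] at hb
      have := hA a (hsub _ _ hb).2.1
      simp only [nbr, if_true]
      omega
  have hout0 : ∀ a, a ∉ A → (outNbr D' a).card = 0 := by
    intro a ha
    rw [Finset.card_eq_zero, Finset.eq_empty_iff_forall_notMem]
    intro b hb
    exact ha (hsub a b (by simpa [outNbr] using hb)).2.1
  have hin0 : ∀ b, b ∉ B → (inNbr D' b).card = 0 := by
    intro b hb
    rw [Finset.card_eq_zero, Finset.eq_empty_iff_forall_notMem]
    intro a ha
    exact hb (hsub a b (by simpa [inNbr] using ha)).2.2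
  have hsumA : ∑ a ∈ A, (outNbr D' a).card = arcCount D' := by
    rw [← sum_card_outNbr]
    exact Finset.sum_subset (Finset.subset_univ _) fun a _ ha => hout0 a ha
  have hsumB : ∑ b ∈ B, (inNbr D' b).card = arcCount D' := by
    rw [← sum_card_inNbr]
    exact Finset.sum_subset (Finset.subset_univ _) fun b _ hb => hin0 b hb
  refine ⟨nbr D', fun a b hb => (hsub a b ((hmemt a b).1 hb)).1, ?_, hlow, ?_, ?_⟩
  · intro m hm
    refine ⟨?_, fun s a ha => hirr s a (hnbr s a ha), ?_, fun s a ha => (hm s).trans (hlow s a ha)⟩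
    · intro s a b hb
      cases s
      · rw [hmemf] at hb; exact (hmemt _ _).2 hb
      · rw [hmemt] at hb; exact (hmemf _ _).2 hb
    · intro s s' a b hab
      by_contra! hlt
      obtain ⟨S, hS, hScard⟩ := Finset.exists_subset_card_eq (Nat.succ_le_of_lt hlt)
      have hS' := hS.trans (Finset.inter_subset_inter (hnbr s a) (hnbr s' b))
      exact hfree ⟨a, b, s, s', S, hab, hScard,
        fun ha => hirr s a (Finset.mem_inter.1 (hS' ha)).1,
        fun hb => hirr s' b (Finset.mem_inter.1 (hS' hb)).2, hS'⟩
  · obtain ⟨⟨a, b⟩, hab⟩ := Finset.card_pos.1 (Nat.zero_lt_of_lt hcount)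
    have hab : D' a b := by simpa using hab
    intro s
    cases s
    · exact ⟨b, a, (hmemf _ _).2 hab⟩
    · exact ⟨a, b, (hmemt _ _).2 hab⟩
  · by_contra! hcon
    have h1 : arcCount D' ≤ A.card * (δ true - 1 + t) := by
      rw [← hsumA]
      refine Finset.sum_le_card_nsmul _ _ _ fun a _ => ?_
      have := hcon true a
      simp only [nbr, if_true] at this
      omega
    have h2 : arcCount D' ≤ B.card * (δ false - 1 + t) := by
      rw [← hsumB]
      refine Finset.sum_le_card_nsmul _ _ _ fun a _ => ?_
      have := hcon false a
      simp only [nbr, Bool.false_eq_true, if_false] at this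
      omega
    obtain ⟨x, hx⟩ : ∃ x, δ true - 1 = t + x := ⟨δ true - 1 - t, by omega⟩
    obtain ⟨y, hy⟩ : ∃ y, δ false - 1 = t + y := ⟨δ false - 1 - t, by omega⟩
    rw [hx] at h1 hcount
    rw [hy] at h2 hcount
    nlinarith [Nat.zero_le (A.card * x), Nat.zero_le (B.card * y)]

end Peeling

section Main

variable {V W : Type*} [DecidableEq V] [DecidableEq W]

variable [Fintype W] {G : SimpleGraph W} [DecidableRel G.Adj]

/-- Two vertices `u`, `v` at distance `p` have total degree at most `k + 2 - p` in a tree with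
`k` edges, and the number of non-leaves is bounded accordingly. -/
theorem degree_add_degree_le (hG : G.IsTree) {k : ℕ} (hW : Fintype.card W = k + 1) {u v : W}
    (huv : u ≠ v) (hdu : 2 ≤ G.degree u) (hdv : 2 ≤ G.degree v) :
    (univ.filter fun y => 2 ≤ G.degree y).card + G.degree u + G.degree v ≤ k + 3 ∧
      G.degree u + G.degree v + G.dist u v ≤ k + 2 := by
  obtain ⟨par, hrt⟩ := exists_isRooted_of_isTree hG u
  have hL := two_mul_add_sum_degree_le hG (Fintype.one_lt_card_iff.2 ⟨u, v, huv⟩) {u, v} (by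
    intro x hx
    rcases Finset.mem_insert.1 hx with rfl | hx
    · exact hdu
    · rw [Finset.mem_singleton.1 hx]; exact hdv)
  rw [Finset.sum_pair huv, Finset.card_pair huv] at hL
  have hsplit := Finset.card_filter_add_card_filter_not (s := univ) fun y => 2 ≤ G.degree y
  rw [Finset.card_univ, hW] at hsplit
  have hdi := hrt.depth_iterate v
  have hpath : G.dist u v + 1 ≤ (univ.filter fun y => 2 ≤ G.degree y).card := by
    calc G.dist u v + 1 = (Finset.range (G.dist u v + 1)).card := (Finset.card_range _).symm
      _ ≤ _ := Finset.card_le_card_of_injOn (fun i => par^[i] v) ?_ ?_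
    · intro i _
      simp only [Finset.coe_filter, Finset.mem_univ, true_and, Set.mem_ofPred_eq]
      cases i with
      | zero => exact hdv
      | succ i =>
        rw [Function.iterate_succ_apply']
        by_cases hi : par^[i] v = u
        · rw [Finset.mem_coe, Finset.mem_range] at *
          have := hdi i (by omega)
          rw [hi, SimpleGraph.dist_self] at this
          omega
        · exact hrt.two_le_degree_par hdu hi
    · intro i hi j hj hij
      simp only [Finset.coe_range, Set.mem_Iio] at hi hj
      have h1 := hdi i (by omega)
      have h2 := hdi j (by omega)
      dsimp only at hij
      rw [hij] at h1
      omega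
  omega

/-- Embedding a tree with two vertices `u`, `v` of large degree; one of them, `r`, is sent to the
prescribed vertex `c`. -/
theorem exists_injective_of_root (hG : G.IsTree) {Nb : Bool → V → Finset V} {t m h k : ℕ}
    (hN : SparseNbr Nb t m) {side : W → Bool} (hside : ∀ x y, G.Adj x y → side x = !side y)
    {δ : Bool → ℕ} (hδ : ∀ s x, (Nb s x).Nonempty → δ s ≤ (Nb s x).card)
    (hW : Fintype.card W = k + 1) {u v : W} (huv : u ≠ v)
    (hm : 3 * t + h + 2 ≤ m) (hm2 : k + 2 + 3 * t ≤ 2 * m + G.degree u)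
    (hm3 : k + 3 ≤ m + G.degree u + G.degree v)
    (hdu : 2 ≤ G.degree u) (hdv : 3 * t + 2 ≤ G.degree v) (hdist : G.dist u v ≤ 2 * h + 2)
    (hau : G.degree u + h ≤ δ (side u)) (hau' : k + 1 ≤ δ (side u) + m)
    (hbv : G.degree v + h ≤ δ (side v)) {r e : W} (hre : r = u ∧ e = v ∨ r = v ∧ e = u)
    {c : V} (hc : (Nb (side r) c).Nonempty)
    (hab : G.degree u + G.degree v + h + t ≤ (Nb (side r) c).card + δ (side e))
    (hab' : k + 1 ≤ (Nb (side r) c).card + δ (side e)) :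
    ∃ F : W → V, Function.Injective F ∧ ∀ x y, G.Adj x y → F y ∈ Nb (side x) (F x) := by
  obtain ⟨par, hrt⟩ := exists_isRooted_of_isTree hG r
  have hr : 2 ≤ G.degree r := by rcases hre with ⟨rfl, rfl⟩ | ⟨rfl, rfl⟩ <;> omega
  have he : 2 ≤ G.degree e := by rcases hre with ⟨rfl, rfl⟩ | ⟨rfl, rfl⟩ <;> omega
  have her : e ≠ r := by
    rcases hre with ⟨rfl, rfl⟩ | ⟨rfl, rfl⟩
    · exact huv.symm
    · exact huv
  have hdep : G.dist r e ≤ 2 * h + 2 := by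
    rcases hre with ⟨rfl, rfl⟩ | ⟨rfl, rfl⟩
    · exact hdist
    · rwa [SimpleGraph.dist_comm]
  have hsidep : ∀ y, y ≠ r → side y = !side (par y) := fun y hy => hside _ _ (hrt.adj_par y hy)
  have hR := (degree_add_degree_le hG hW huv hdu (by omega)).1
  obtain ⟨f, hfr, hf, h1, h2, h3⟩ := hrt.exists_partialEmb hN hm hsidep
    (R := univ.filter fun y => 2 ≤ G.degree y)
    (fun y _ hy => Finset.mem_filter.2 ⟨Finset.mem_univ _, hrt.two_le_degree_par hr hy⟩)
    (by omega) her (Finset.mem_filter.2 ⟨Finset.mem_univ _, he⟩) hdep hc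
  have hne : ∀ y, 2 ≤ G.degree y → δ (side y) ≤ (Nb (side y) (f y)).card := fun y hy =>
    hδ _ _ (hf.nonempty hN hsidep (Finset.mem_filter.2 ⟨Finset.mem_univ _, hy⟩))
  have hu := hne u hdu
  have hv := hne v (by omega)
  have hne' := hne e he
  rw [← hfr] at hab hab'
  obtain ⟨F, hFinj, hF⟩ : ∃ F : W → V, Function.Injective F ∧
      ∀ y, y ≠ r → F y ∈ Nb (side (par y)) (F (par y)) := by
    rcases hre with ⟨rfl, rfl⟩ | ⟨rfl, rfl⟩
    · exact hf.exists_injective hG hrt hr hN hsidep hW huv (h1.mono (Nat.zero_le h)) h2 h3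
        hm hm2 hm3 hdu hdv (by omega) (by omega) (by omega) (by omega) (by omega)
    · refine hf.exists_injective hG hrt hr hN hsidep hW huv h2 (h1.mono (Nat.zero_le h)) ?_
        hm hm2 hm3 hdu hdv (by omega) (by omega) (by omega) (by omega) (by omega)
      rw [Finset.union_comm]
      simpa only [add_comm] using h3
  refine ⟨F, hFinj, fun x y hxy => ?_⟩
  rcases hrt.of_adj x y hxy with ⟨hx, rfl⟩ | ⟨hy, rfl⟩
  · rw [hsidep x hx]
    exact hN.symm _ _ _ (hF x hx)
  · exact hF y hy

end Main

section Translation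

variable {W : Type*} [Fintype W] {T : W → W → Bool}

theorem Antidirected.degree_underG [DecidableEq W] (hT : Antidirected T)
    [DecidableRel (underG T).Adj] (y : W) :
    (underG T).degree y = totalDeg T y := by
  rw [totalDeg, ← Finset.card_union_of_disjoint, ← SimpleGraph.card_neighborFinset_eq_degree]
  · congr 1
    ext z
    rw [SimpleGraph.mem_neighborFinset, underG, SimpleGraph.fromRel_adj]
    simp only [outNbr, inNbr, Finset.mem_union, Finset.mem_filter, Finset.mem_univ, true_and,
      and_iff_right_iff_imp]
    rintro (h | h) rfl <;> exact hT _ _ _ h h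
  · rw [Finset.disjoint_left]
    intro z hz hz'
    simp only [outNbr, inNbr, Finset.mem_filter, Finset.mem_univ, true_and] at hz hz'
    exact hT _ _ _ hz hz'

theorem Antidirected.card_of_isTree (hT : Antidirected T) (htree : (underG T).IsTree) :
    Fintype.card W = arcCount T + 1 := by
  classical
  have h1 := (underG T).sum_degrees_eq_twice_card_edges
  have h2 := htree.card_edgeFinset
  simp only [hT.degree_underG, totalDeg, Finset.sum_add_distrib, sum_card_outNbr,
    sum_card_inNbr] at h1
  omega

theorem exists_two_of_le_secondMaxDeg {K : ℕ} (hK : 0 < K) (h : K ≤ secondMaxDeg T) :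
    ∃ u v, u ≠ v ∧ totalDeg T v ≤ totalDeg T u ∧ K ≤ totalDeg T v := by
  classical
  have hne : (univ : Finset W).Nonempty := by
    rw [Finset.nonempty_iff_ne_empty]
    intro h0
    simp only [secondMaxDeg, h0, Finset.empty_val, Multiset.map_zero, Multiset.erase_zero,
      Multiset.sup_zero, Nat.bot_eq_zero] at h
    omega
  obtain ⟨u, -, hu⟩ := Finset.exists_mem_eq_sup univ hne (totalDeg T)
  have hmax : ∀ v, totalDeg T v ≤ totalDeg T u := fun v =>
    hu ▸ Finset.le_sup (f := totalDeg T) (Finset.mem_univ v)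
  have hval : (univ : Finset W).val = u ::ₘ (univ.erase u).val := by
    rw [← Finset.insert_val_of_notMem (Finset.notMem_erase u _),
      Finset.insert_erase (Finset.mem_univ u)]
  rw [secondMaxDeg, maxDeg, hu, hval, Multiset.map_cons, Multiset.erase_cons_head] at h
  by_contra! hcon
  have : ((univ.erase u).val.map (totalDeg T)).sup ≤ K - 1 := by
    refine Multiset.sup_le.2 fun b hb => ?_
    obtain ⟨v, hv, rfl⟩ := Multiset.mem_map.1 hb
    have := hcon u v (Finset.ne_of_mem_erase hv).symm (hmax v)
    omega
  omega

/-- The minimum degrees `α`, `β` on the two sides, when `u` and `v` are on different sides. -/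
theorem exists_min_degrees_of_ne {k t p du dv : ℕ} (ht : (k + 11) / 12 = t + 1)
    (hv : k / 4 + 3 ≤ dv) (hvu : dv ≤ du) (hp : 0 < p) (hsum : du + dv + p ≤ k + 2) :
    ∃ α β : ℕ, α + β = k + 1 ∧ du + (p - 1) / 2 ≤ α ∧ k + 1 ≤ 2 * α ∧
      3 * t + (p - 1) / 2 + 2 ≤ β ∧ β ≤ α ∧ k + 2 + 3 * t ≤ 2 * β + du ∧ k + 3 ≤ β + du + dv ∧
      dv + (p - 1) / 2 ≤ β := by
  obtain ⟨h, hh⟩ : ∃ h, h = (p - 1) / 2 := ⟨_, rfl⟩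
  rw [← hh]
  rcases le_total (du + h) ((k + 2) / 2) with hle | hle
  · refine ⟨(k + 2) / 2, k + 1 - (k + 2) / 2, ?_, ?_, ?_, ?_, ?_, ?_, ?_, ?_⟩ <;> omega
  · refine ⟨du + h, k + 1 - (du + h), ?_, ?_, ?_, ?_, ?_, ?_, ?_, ?_⟩ <;> omega

/-- The minimum degrees `α`, `β` on the two sides, when `u` and `v` are on the same side. -/
theorem exists_min_degrees_of_eq {k t p du dv : ℕ} (ht : (k + 11) / 12 = t + 1)
    (hv : k / 4 + 3 ≤ dv) (hvu : dv ≤ du) (hp : 0 < p) (hsum : du + dv + p ≤ k + 2) :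
    ∃ α β : ℕ, α + β = k + 1 ∧ du + (p - 1) / 2 ≤ α ∧ k + 1 ≤ 2 * α ∧
      3 * t + (p - 1) / 2 + 2 ≤ β ∧ β ≤ α ∧ k + 2 + 3 * t ≤ 2 * β + du ∧ k + 3 ≤ β + du + dv ∧
      du + dv + (p - 1) / 2 + t ≤ 2 * α := by
  obtain ⟨h, hh⟩ : ∃ h, h = (p - 1) / 2 := ⟨_, rfl⟩
  rw [← hh]
  by_cases h1 : du + dv + h + t ≤ 2 * max (du + h) ((k + 2) / 2)
  · rcases le_total (du + h) ((k + 2) / 2) with hle | hle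
    · rw [max_eq_right hle] at h1
      refine ⟨(k + 2) / 2, k + 1 - (k + 2) / 2, ?_, ?_, ?_, ?_, ?_, ?_, ?_, ?_⟩ <;> omega
    · rw [max_eq_left hle] at h1
      refine ⟨du + h, k + 1 - (du + h), ?_, ?_, ?_, ?_, ?_, ?_, ?_, ?_⟩ <;> omega
  · have h2 := le_max_left (du + h) ((k + 2) / 2)
    have h3 := le_max_right (du + h) ((k + 2) / 2)
    refine ⟨(du + dv + h + t + 1) / 2, k + 1 - (du + dv + h + t + 1) / 2,
      ?_, ?_, ?_, ?_, ?_, ?_, ?_, ?_⟩ <;> omega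

end Translation

/-- If `Δ₂(T) ≥ ⌊k/4⌋ + 3`, then the antidirected tree `T` with `k` arcs
embeds in every `𝒦_{2,s}`-free digraph with more than `(k−1)·n` arcs. -/
theorem stmt_4 (k : ℕ) (hk : 0 < k)
    {V : Type*} [Fintype V] [DecidableEq V]
    (D : V → V → Bool) (hloop : Loopless D)
    (hfree : K2sFree D ((k + 11) / 12))
    (harcs : (k - 1) * Fintype.card V < arcCount D)
    {W : Type*} [Fintype W] [DecidableEq W]
    (T : W → W → Bool) (hT : Antidirected T)
    (htree : (underG T).IsTree) (hkT : arcCount T = k)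
    (hD2 : k / 4 + 3 ≤ secondMaxDeg T) :
    Embeds T D := by
  classical
  obtain ⟨u, v, huv, hvu, hv⟩ := exists_two_of_le_secondMaxDeg (by omega) hD2
  have hW := hT.card_of_isTree htree
  rw [hkT] at hW
  rw [← hT.degree_underG] at hv hvu
  rw [← hT.degree_underG] at hvu
  set du := (underG T).degree u with hdu
  set dv := (underG T).degree v with hdv
  obtain ⟨-, hsum⟩ := degree_add_degree_le htree hW huv (by omega) (by omega)
  have hdist : 0 < (underG T).dist u v := htree.connected.pos_dist_of_ne huv
  set h := ((underG T).dist u v - 1) / 2 with hh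
  set side : W → Bool := fun y => decide (∃ z, T y z) with hsidedef
  have hsideT : ∀ x y, T x y → side x = true ∧ side y = false := by
    intro x y hxy
    simp only [hsidedef, decide_eq_true_eq, decide_eq_false_iff_not]
    exact ⟨⟨y, hxy⟩, fun ⟨z, hz⟩ => hT _ _ _ hxy hz⟩
  have hside : ∀ x y, (underG T).Adj x y → side x = !side y := by
    intro x y hxy
    rcases ((SimpleGraph.fromRel_adj _ _ _).1 hxy).2 with hxy | hxy <;>
      simp [(hsideT _ _ hxy).1, (hsideT _ _ hxy).2]
  obtain ⟨t, ht⟩ : ∃ t, (k + 11) / 12 = t + 1 := ⟨(k + 11) / 12 - 1, by omega⟩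
  rw [ht] at hfree
  obtain ⟨α, β, hαβ, hα, hα', hβt, hβα, hβ1, hβ2, hvα, hvβ⟩ : ∃ α β : ℕ, α + β = k + 1 ∧
      du + h ≤ α ∧ k + 1 ≤ 2 * α ∧ 3 * t + h + 2 ≤ β ∧ β ≤ α ∧ k + 2 + 3 * t ≤ 2 * β + du ∧
      k + 3 ≤ β + du + dv ∧
      (side v = side u → du + dv + h + t ≤ 2 * α) ∧ (side v ≠ side u → dv + h ≤ β) := by
    by_cases hs : side v = side u
    · obtain ⟨α, β, h1, h2, h3, h4, h5, h6, h7, h8⟩ :=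
        exists_min_degrees_of_eq ht hv hvu hdist hsum
      exact ⟨α, β, h1, h2, h3, h4, h5, h6, h7, fun _ => h8, fun hne => absurd hs hne⟩
    · obtain ⟨α, β, h1, h2, h3, h4, h5, h6, h7, h8⟩ :=
        exists_min_degrees_of_ne ht hv hvu hdist hsum
      exact ⟨α, β, h1, h2, h3, h4, h5, h6, h7, fun heq => absurd heq hs, fun _ => h8⟩
  set δ : Bool → ℕ := fun s => if s = side u then α else β with hδdef
  have hδu : δ (side u) = α := if_pos rfl
  have hδne : ∀ s, s ≠ side u → δ s = β := fun s hs => if_neg hs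
  have hδβ : ∀ s, β ≤ δ s := by
    intro s
    by_cases hs : s = side u
    · rw [hs, hδu]; exact hβα
    · rw [hδne s hs]
  have hδsum : δ true + δ false = k + 1 := by
    cases hs : side u <;> rw [hs] at hδu hδne
    · rw [hδu, hδne true (by simp)]; omega
    · rw [hδu, hδne false (by simp)]; omega
  obtain ⟨Nb, hNbD, hsparse, hδ, hact, s, c₀, hc₀⟩ := exists_sparseNbr D hloop hfree (δ := δ)
    (fun s => by have := hδβ s; omega) (by rw [hδsum]; exact harcs)
  have hN := hsparse β hδβ
  have hbv : dv + h ≤ δ (side v) := by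
    by_cases hs : side v = side u
    · rw [hs, hδu]; omega
    · rw [hδne _ hs]; exact hvβ hs
  obtain ⟨r, e, c, hre, hc, hab, hab'⟩ : ∃ r e c, (r = u ∧ e = v ∨ r = v ∧ e = u) ∧
      (Nb (side r) c).Nonempty ∧ du + dv + h + t ≤ (Nb (side r) c).card + δ (side e) ∧
      k + 1 ≤ (Nb (side r) c).card + δ (side e) := by
    by_cases hs : side v = side u
    · obtain ⟨c, hc⟩ := hact (side u)
      have := hδ _ _ hc
      have := hvα hs
      refine ⟨u, v, c, Or.inl ⟨rfl, rfl⟩, hc, ?_, ?_⟩ <;> rw [hs, hδu] at * <;> omega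
    · have hδs := hδβ s
      have hne : (Nb s c₀).Nonempty := Finset.card_pos.1 (by omega)
      by_cases hsu : s = side u
      · subst hsu
        refine ⟨u, v, c₀, Or.inl ⟨rfl, rfl⟩, hne, ?_, ?_⟩ <;> rw [hδne _ hs] <;>
          rw [hδu] at hc₀ <;> omega
      · have hsv : s = side v := (Bool.eq_not.2 hsu).trans (Bool.eq_not.2 hs).symm
        subst hsv
        refine ⟨v, u, c₀, Or.inr ⟨rfl, rfl⟩, hne, ?_, ?_⟩ <;> rw [hδu] <;>
          rw [hδne _ hs] at hc₀ <;> omega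
  obtain ⟨F, hFinj, hF⟩ := exists_injective_of_root htree hN hside hδ hW huv hβt hβ1 hβ2
    (by omega) (by omega) (by omega) (by rw [hδu]; exact hα) (by rw [hδu]; omega) hbv hre hc
    hab hab'
  refine ⟨F, hFinj, fun x y hxy => hNbD _ _ ?_⟩
  rw [← (hsideT x y hxy).1]
  refine hF x y ((SimpleGraph.fromRel_adj _ _ _).2 ⟨?_, Or.inl hxy⟩)
  rintro rfl
  exact hT _ _ _ hxy hxy
end

section
/- Let n, k be positive integers, let D be a digraph on n vertices with a(D) > (k−1)·(|D⁺| + |D⁻|)/2, and let T be an antidirected caterpillar with exactly k arcs. Suppose that at least one of the following holds: (i) |D⁺| ≤ |D⁻| and |T⁺| ≤ |T⁻|; or (ii) |D⁺| ≥ |D⁻| and |T⁺| ≥ |T⁻|. Then T embeds in D. -/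
open Finset

section Caterpillar

variable {V W : Type*}

/-- Deleting from a finite set the elements of minimal cost in each fibre of `g` removes at most
as many elements as there are fibres, when costs are distinct within each fibre. -/
theorem card_le_card_filter_exists_lt_add {α β : Type*} (A : Finset α)
    (O : Finset β) (g : α → β) (c : α → ℕ) (hg : ∀ p ∈ A, g p ∈ O)
    (hc : ∀ p ∈ A, ∀ q ∈ A, g p = g q → c p = c q → p = q)
    [DecidablePred fun p => ∃ q ∈ A, g q = g p ∧ c q < c p] :
    A.card ≤ (A.filter fun p => ∃ q ∈ A, g q = g p ∧ c q < c p).card + O.card := by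
  rw [← card_filter_add_card_filter_not (s := A) (fun p => ∃ q ∈ A, g q = g p ∧ c q < c p)]
  refine Nat.add_le_add_left (card_le_card_of_injOn g ?_ ?_) _
  · intro p hp
    exact hg p (mem_filter.1 hp).1
  · intro p hp q hq hpq
    obtain ⟨hpA, hp⟩ := mem_filter.1 hp
    obtain ⟨hqA, hq⟩ := mem_filter.1 hq
    push Not at hp hq
    exact hc p hpA q hqA hpq (le_antisymm (hp q hqA hpq.symm) (hq p hpA hpq))

/-- Clockwise distance from `u` to `v` with respect to a cyclic labelling `e`. -/
def cdist {n : ℕ} (e : V ≃ Fin n) (u v : V) : ℕ :=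
  if (e u : ℕ) ≤ e v then e v - e u else e v + n - e u

theorem cdist_right_inj {n : ℕ} (e : V ≃ Fin n) {u v w : V} (h : cdist e u v = cdist e u w) :
    v = w := by
  apply e.injective
  apply Fin.ext
  have := (e u).isLt
  have := (e v).isLt
  have := (e w).isLt
  unfold cdist at h
  split_ifs at h <;> omega

theorem cdist_left_inj {n : ℕ} (e : V ≃ Fin n) {u v w : V} (h : cdist e v u = cdist e w u) :
    v = w := by
  apply e.injective
  apply Fin.ext
  have := (e u).isLt
  have := (e v).isLt
  have := (e w).isLt
  unfold cdist at h
  split_ifs at h <;> omega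

theorem cdist_le_of_lt {n : ℕ} (e : V ≃ Fin n) {u u' v w : V}
    (h : cdist e u v < cdist e u' v) (hw : cdist e u w ≤ cdist e u v) :
    cdist e u' w ≤ cdist e u' v ∧ w ≠ u' := by
  have := (e u).isLt
  have := (e u').isLt
  have := (e v).isLt
  have := (e w).isLt
  constructor
  · unfold cdist at *
    split_ifs at * <;> omega
  · rintro rfl
    unfold cdist at *
    split_ifs at * <;> omega

theorem mem_outVerts [Fintype W] {T : W → W → Bool} {x y : W} (h : T x y) : x ∈ outVerts T := by
  simp only [outVerts, mem_filter, mem_univ, true_and]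
  exact card_ne_zero_of_mem (a := y) (by simp [outNbr, h])

theorem mem_inVerts [Fintype W] {T : W → W → Bool} {x y : W} (h : T x y) : y ∈ inVerts T := by
  simp only [inVerts, mem_filter, mem_univ, true_and]
  exact card_ne_zero_of_mem (a := x) (by simp [inNbr, h])

theorem Antidirected.disjoint [Fintype W] {T : W → W → Bool} (hT : Antidirected T) :
    Disjoint (outVerts T) (inVerts T) := by
  rw [disjoint_left]
  intro v h1 h2
  simp only [outVerts, inVerts, mem_filter, mem_univ, true_and, card_ne_zero] at h1 h2
  obtain ⟨x, hx⟩ := h1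
  obtain ⟨y, hy⟩ := h2
  simp only [outNbr, inNbr, mem_filter, mem_univ, true_and] at hx hy
  exact hT y v x hy hx

theorem underG_adj {T : W → W → Bool} {x y : W} : (underG T).Adj x y ↔ x ≠ y ∧ (T x y ∨ T y x) := by
  simp [underG]

theorem Antidirected.arcCount_lt_card [Fintype W] {T : W → W → Bool} (hT : Antidirected T)
    (htree : (underG T).IsTree) : arcCount T < Fintype.card W := by
  classical
  rw [← htree.card_edgeFinset, Nat.lt_succ_iff]
  refine card_le_card_of_injOn (fun p => s(p.1, p.2)) ?_ ?_
  · rintro ⟨x, y⟩ hp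
    have hp : T x y := (mem_filter.1 hp).2
    simp only [SimpleGraph.coe_edgeFinset, SimpleGraph.mem_edgeSet, underG_adj]
    refine ⟨?_, Or.inl hp⟩
    rintro rfl
    exact hT _ _ _ hp hp
  · rintro ⟨x, y⟩ hp ⟨x', y'⟩ hq hpq
    have hp : T x y := (mem_filter.1 hp).2
    have hq : T x' y' := (mem_filter.1 hq).2
    rcases Sym2.eq_iff.1 hpq with ⟨rfl, rfl⟩ | ⟨rfl, rfl⟩
    · rfl
    · exact (hT _ _ _ hp hq).elim

theorem injOn_update [DecidableEq W] {S : Finset W} {f : W → V} (hf : Set.InjOn f S) {x : W} {v : V}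
    (hv : ∀ y ∈ S, f y ≠ v) :
    Set.InjOn (Function.update f x v) (insert x S : Finset W) := by
  intro y hy z hz hyz
  simp only [coe_insert, Set.mem_insert_iff, mem_coe] at hy hz
  simp only [Function.update_apply] at hyz
  have := @hf y
  grind

/-- `Zigzag T S F a b s t`: the arcs `F` form a subtree of `T` with vertex set `S`, built from one
arc by adding arcs one at a time, each containing exactly one end of its predecessor. The last arc
is `ab`; `s` arcs brought a new out-vertex and `t` arcs a new in-vertex. -/
inductive Zigzag [DecidableEq W] (T : W → W → Bool) :
    Finset W → Finset (W × W) → W → W → ℕ → ℕ → Prop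
  | base {a b : W} (h : T a b) : Zigzag T {a, b} {(a, b)} a b 0 0
  | addIn {S F a b s t} (x : W) (h : Zigzag T S F a b s t) (hx : x ∉ S) (hT : T a x) :
      Zigzag T (insert x S) (insert (a, x) F) a x s (t + 1)
  | addOut {S F a b s t} (x : W) (h : Zigzag T S F a b s t) (hx : x ∉ S) (hT : T x b) :
      Zigzag T (insert x S) (insert (x, b) F) x b (s + 1) t

section Zigzag

variable [DecidableEq W] {T : W → W → Bool} {S : Finset W} {F : Finset (W × W)} {a b : W} {s t : ℕ}

theorem Zigzag.mem (h : Zigzag T S F a b s t) :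
    a ∈ S ∧ b ∈ S ∧ ∀ p ∈ F, T p.1 p.2 ∧ p.1 ∈ S ∧ p.2 ∈ S := by
  induction h with
  | base h => simp [h]
  | addIn x h hx hT ih => grind
  | addOut x h hx hT ih => grind

theorem Zigzag.card [Fintype W] (hT : Antidirected T) (h : Zigzag T S F a b s t) :
    (S ∩ outVerts T).card = s + 1 ∧ (S ∩ inVerts T).card = t + 1 ∧
      F.card = s + t + 1 ∧ S.card = s + t + 2 := by
  have hd := disjoint_left.1 hT.disjoint
  induction h with
  | @base a b h =>
    have ha := mem_outVerts h
    have hb := mem_inVerts h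
    have hb' : b ∉ outVerts T := fun h => hd h hb
    have hab : a ≠ b := fun h => hb' (h ▸ ha)
    simp [insert_inter_of_mem, insert_inter_of_notMem, singleton_inter_of_notMem,
      singleton_inter_of_mem, ha, hb, hb', hd ha, hab]
  | @addIn S F a b s t x h hx hTx ih =>
    have hb := mem_inVerts hTx
    have hF : (a, x) ∉ F := fun hm => hx (h.mem.2.2 _ hm).2.2
    rw [insert_inter_of_mem hb, insert_inter_of_notMem (fun h => hd h hb),
      card_insert_of_notMem (by simp [hx]), card_insert_of_notMem hF, card_insert_of_notMem hx]
    omega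
  | @addOut S F a b s t x h hx hTx ih =>
    have ha := mem_outVerts hTx
    have hF : (x, b) ∉ F := fun hm => hx (h.mem.2.2 _ hm).2.1
    rw [insert_inter_of_mem ha, insert_inter_of_notMem (hd ha),
      card_insert_of_notMem (by simp [hx]), card_insert_of_notMem hF, card_insert_of_notMem hx]
    omega

end Zigzag

section GoodPairs

variable [Fintype V] {n : ℕ}

open Classical in
/-- Arcs `uv` of `D` onto which `ab` can be mapped by an embedding of the digraph `(S, F)` whose
image lies in the clockwise interval from `u` to `v`. -/
noncomputable def goodPairs (e : V ≃ Fin n) (D : V → V → Bool) (S : Finset W)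
    (F : Finset (W × W)) (a b : W) : Finset (V × V) :=
  univ.filter fun p => D p.1 p.2 ∧ ∃ f : W → V, Set.InjOn f S ∧ (∀ x ∈ F, D (f x.1) (f x.2)) ∧
    f a = p.1 ∧ f b = p.2 ∧ ∀ x ∈ S, cdist e p.1 (f x) ≤ cdist e p.1 p.2

theorem mem_goodPairs {e : V ≃ Fin n} {D : V → V → Bool} {S : Finset W}
    {F : Finset (W × W)} {a b : W} {u v : V} :
    (u, v) ∈ goodPairs e D S F a b ↔
      D u v ∧ ∃ f : W → V, Set.InjOn f S ∧ (∀ x ∈ F, D (f x.1) (f x.2)) ∧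
        f a = u ∧ f b = v ∧ ∀ x ∈ S, cdist e u (f x) ≤ cdist e u v := by
  simp [goodPairs]

variable [DecidableEq W] {T : W → W → Bool} {S : Finset W} {F : Finset (W × W)} {a b : W} {s t : ℕ}
  {e : V ≃ Fin n} {D : V → V → Bool}

theorem Zigzag.mem_goodPairs_addIn (h : Zigzag T S F a b s t) {x : W} (hx : x ∉ S)
    {u v v' : V} (hg : (u, v) ∈ goodPairs e D S F a b) (hD : D u v')
    (hlt : cdist e u v < cdist e u v') :
    (u, v') ∈ goodPairs e D (insert x S) (insert (a, x) F) a x := by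
  rw [mem_goodPairs] at hg ⊢
  obtain ⟨-, f, hf, hF, hfa, -, hle⟩ := hg
  have hm := h.mem
  have hne : ∀ y ∈ S, Function.update f x v' y = f y := fun y hy =>
    Function.update_of_ne (ne_of_mem_of_not_mem hy hx) _ _
  refine ⟨hD, Function.update f x v', injOn_update hf ?_, ?_, ?_, by simp, ?_⟩
  · rintro y hy rfl
    exact absurd (hle y hy) (by omega)
  · intro p hp
    rcases mem_insert.1 hp with rfl | hp
    · simpa [hne a hm.1, hfa] using hD
    · rw [hne _ (hm.2.2 p hp).2.1, hne _ (hm.2.2 p hp).2.2]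
      exact hF p hp
  · rw [hne a hm.1, hfa]
  · intro y hy
    rcases mem_insert.1 hy with rfl | hy
    · simp
    · rw [hne y hy]
      exact (hle y hy).trans hlt.le

theorem Zigzag.mem_goodPairs_addOut (h : Zigzag T S F a b s t) {x : W} (hx : x ∉ S)
    {u u' v : V} (hg : (u, v) ∈ goodPairs e D S F a b) (hD : D u' v)
    (hlt : cdist e u v < cdist e u' v) :
    (u', v) ∈ goodPairs e D (insert x S) (insert (x, b) F) x b := by
  rw [mem_goodPairs] at hg ⊢
  obtain ⟨-, f, hf, hF, -, hfb, hle⟩ := hg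
  have hm := h.mem
  have hne : ∀ y ∈ S, Function.update f x u' y = f y := fun y hy =>
    Function.update_of_ne (ne_of_mem_of_not_mem hy hx) _ _
  refine ⟨hD, Function.update f x u', injOn_update hf ?_, ?_, by simp, ?_, ?_⟩
  · intro y hy
    exact (cdist_le_of_lt e hlt (hle y hy)).2
  · intro p hp
    rcases mem_insert.1 hp with rfl | hp
    · simpa [hne b hm.2.1, hfb] using hD
    · rw [hne _ (hm.2.2 p hp).2.1, hne _ (hm.2.2 p hp).2.2]
      exact hF p hp
  · rw [hne b hm.2.1, hfb]
  · intro y hy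
    rcases mem_insert.1 hy with rfl | hy
    · simp [cdist]
    · rw [hne y hy]
      exact (cdist_le_of_lt e hlt (hle y hy)).1

theorem Zigzag.arcCount_le (hT : Antidirected T) (hloop : Loopless D)
    (h : Zigzag T S F a b s t) :
    arcCount D ≤ (goodPairs e D S F a b).card + s * (inVerts D).card + t * (outVerts D).card := by
  classical
  induction h with
  | @base a b h =>
    simp only [zero_mul, add_zero]
    refine card_le_card ?_
    rintro ⟨u, v⟩ hp
    have hD : D u v := (mem_filter.1 hp).2
    have hab : a ≠ b := by
      rintro rfl
      exact hT _ _ _ h h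
    have huv : u ≠ v := by
      rintro rfl
      exact hloop _ hD
    refine mem_goodPairs.2 ⟨hD, fun w => if w = a then u else v, ?_, ?_, by simp,
      by simp [hab.symm], ?_⟩
    · intro y hy z hz
      simp only [coe_insert, coe_singleton, Set.mem_insert_iff, Set.mem_singleton_iff] at hy hz
      grind
    · simp [hab.symm, hD]
    · simp [hab.symm, cdist]
  | @addIn S F a b s t x h hx hTx ih =>
    refine ih.trans ?_
    have h1 := card_le_card_filter_exists_lt_add (goodPairs e D S F a b) (outVerts D) Prod.fst
      (fun p => cdist e p.1 p.2)
      (fun p hp => mem_outVerts (mem_goodPairs.1 hp).1)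
      (by
        rintro ⟨u, v⟩ - ⟨u', v'⟩ - rfl hc
        exact Prod.ext rfl (cdist_right_inj e hc))
    have h2 := card_le_card (s := (goodPairs e D S F a b).filter fun p =>
        ∃ q ∈ goodPairs e D S F a b, q.1 = p.1 ∧ cdist e q.1 q.2 < cdist e p.1 p.2)
      (t := goodPairs e D (insert x S) (insert (a, x) F) a x) (by
        rintro ⟨u, v⟩ hp
        obtain ⟨hp, ⟨u', v'⟩, hq, rfl, hlt⟩ := mem_filter.1 hp
        exact h.mem_goodPairs_addIn hx hq (mem_goodPairs.1 hp).1 hlt)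
    linarith
  | @addOut S F a b s t x h hx hTx ih =>
    refine ih.trans ?_
    have h1 := card_le_card_filter_exists_lt_add (goodPairs e D S F a b) (inVerts D) Prod.snd
      (fun p => cdist e p.1 p.2)
      (fun p hp => mem_inVerts (mem_goodPairs.1 hp).1)
      (by
        rintro ⟨u, v⟩ - ⟨u', v'⟩ - rfl hc
        exact Prod.ext (cdist_left_inj e hc) rfl)
    have h2 := card_le_card (s := (goodPairs e D S F a b).filter fun p =>
        ∃ q ∈ goodPairs e D S F a b, q.2 = p.2 ∧ cdist e q.1 q.2 < cdist e p.1 p.2)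
      (t := goodPairs e D (insert x S) (insert (x, b) F) x b) (by
        rintro ⟨u, v⟩ hp
        obtain ⟨hp, ⟨u', v'⟩, hq, rfl, hlt⟩ := mem_filter.1 hp
        exact h.mem_goodPairs_addOut hx hq (mem_goodPairs.1 hp).1 hlt)
    linarith

end GoodPairs

section Spanning

variable [DecidableEq W] {T : W → W → Bool} {S : Finset W} {c d : W}

/-- `S` is the vertex set of a zigzag whose last arc joins `c` and `d` in some direction. -/
def ZigzagOn (T : W → W → Bool) (S : Finset W) (c d : W) : Prop :=
  ∃ F s t, Zigzag T S F c d s t ∨ Zigzag T S F d c s t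

theorem ZigzagOn.symm (h : ZigzagOn T S c d) : ZigzagOn T S d c := by
  obtain ⟨F, s, t, h⟩ := h
  exact ⟨F, s, t, h.symm⟩

theorem ZigzagOn.base (h : (underG T).Adj c d) : ZigzagOn T {c, d} c d := by
  rcases (underG_adj.1 h).2 with h | h
  · exact ⟨_, _, _, Or.inl (.base h)⟩
  · rw [pair_comm]
    exact ⟨_, _, _, Or.inr (.base h)⟩

theorem Zigzag.rel {F a b s t} (h : Zigzag T S F a b s t) : T a b := by
  cases h <;> assumption

theorem ZigzagOn.mem (h : ZigzagOn T S c d) : c ∈ S := by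
  obtain ⟨F, s, t, h | h⟩ := h
  · exact h.mem.1
  · exact h.mem.2.1

theorem ZigzagOn.insert (hT : Antidirected T) (h : ZigzagOn T S c d) {x : W} (hx : x ∉ S)
    (hadj : (underG T).Adj c x) : ZigzagOn T (insert x S) c x := by
  obtain ⟨F, s, t, h | h⟩ := h
  · rcases (underG_adj.1 hadj).2 with hc | hc
    · exact ⟨_, _, _, Or.inl (.addIn x h hx hc)⟩
    · exact (hT _ _ _ hc h.rel).elim
  · rcases (underG_adj.1 hadj).2 with hc | hc
    · exact (hT _ _ _ h.rel hc).elim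
    · exact ⟨_, _, _, Or.inr (.addOut x h hx hc)⟩

theorem ZigzagOn.union (hT : Antidirected T) (h : ZigzagOn T S c d) (L : Finset W)
    (hL : ∀ x ∈ L, (underG T).Adj c x) : ∃ d', ZigzagOn T (L ∪ S) c d' := by
  induction L using Finset.induction_on with
  | empty => exact ⟨d, by simpa using h⟩
  | insert x L _ ih =>
    obtain ⟨d', h'⟩ := ih fun y hy => hL y (mem_insert_of_mem hy)
    rw [insert_union]
    by_cases hx : x ∈ L ∪ S
    · exact ⟨d', by rwa [insert_eq_of_mem hx]⟩
    · exact ⟨x, h'.insert hT hx (hL x (mem_insert_self _ _))⟩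

/-- A zigzag ending at the start of a path extends along the path, collecting all neighbours of
the path outside `Q`. -/
theorem ZigzagOn.extend_along [Fintype W] (hT : Antidirected T) {Q : Finset W} {c y : W}
    (P : (underG T).Walk c y) (hP : P.IsPath) (hQ : ∀ v ∈ P.support, v ∈ Q)
    {S : Finset W} {d : W} (h : ZigzagOn T S c d) (hS : ∀ v ∈ P.support, v ∈ S → v = c) :
    ∃ S' c' d', ZigzagOn T S' c' d' ∧ S ⊆ S' ∧ (∀ v ∈ P.support, v ∈ S') ∧
      ∀ w ∈ P.support, ∀ v, (underG T).Adj v w → v ∉ Q → v ∈ S' := by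
  classical
  induction P generalizing S d with
  | @nil c =>
    obtain ⟨d', h'⟩ := h.union hT (univ.filter fun v => (underG T).Adj c v ∧ v ∉ Q)
      (by simp +contextual)
    refine ⟨_, c, d', h', subset_union_right, by simp [h.mem], ?_⟩
    intro w hw v hv hvQ
    obtain rfl : w = c := by simpa using hw
    simp [hv.symm, hvQ]
  | @cons c c₁ y hadj P ih =>
    obtain ⟨d', h'⟩ := h.union hT (univ.filter fun v => (underG T).Adj c v ∧ v ∉ Q)
      (by simp +contextual)
    rw [SimpleGraph.Walk.cons_isPath_iff] at hP
    simp only [SimpleGraph.Walk.support_cons, List.mem_cons, forall_eq_or_imp] at hQ hS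
    have hnot : ∀ v ∈ P.support,
        v ∉ (univ.filter fun v => (underG T).Adj c v ∧ v ∉ Q) ∪ S := by
      intro v hv hm
      rcases mem_union.1 hm with hm | hm
      · exact (mem_filter.1 hm).2.2 (hQ.2 v hv)
      · exact hP.2 (hS.2 v hv hm ▸ hv)
    have h'' := (h'.insert hT (hnot c₁ P.start_mem_support) hadj).symm
    obtain ⟨S', c', d'', hz, hsub, hsupp, hN⟩ := ih hP.1 hQ.2 h'' (fun v hv hm =>
      (mem_insert.1 hm).resolve_right (hnot v hv))
    refine ⟨S', c', d'', hz, fun v hv => hsub (by simp [hv]), ?_, ?_⟩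
    · simp only [SimpleGraph.Walk.support_cons, List.mem_cons, forall_eq_or_imp]
      exact ⟨hsub (by simp [h.mem]), hsupp⟩
    · simp only [SimpleGraph.Walk.support_cons, List.mem_cons, forall_eq_or_imp]
      exact ⟨fun v hv hvQ => hsub (by simp [hv.symm, hvQ]), hN⟩

theorem IsCaterpillarG.exists_zigzagOn_univ [Fintype W] [Nontrivial W] (hT : Antidirected T)
    (hcat : IsCaterpillarG (underG T)) : ∃ c d, ZigzagOn T univ c d := by
  classical
  obtain ⟨htree, x, y, P, hP, hdom⟩ := hcat
  suffices H : ∃ S c d, ZigzagOn T S c d ∧ (∀ v ∈ P.support, v ∈ S) ∧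
      ∀ w ∈ P.support, ∀ v, (underG T).Adj v w → v ∉ P.support.toFinset → v ∈ S by
    obtain ⟨S, c, d, hz, h1, h2⟩ := H
    obtain rfl : S = univ := by
      refine eq_univ_of_forall fun v => ?_
      by_cases hv : v ∈ P.support
      · exact h1 v hv
      · obtain ⟨w, hw, hvw⟩ := (hdom v).resolve_left hv
        exact h2 w hw v hvw (by simpa using hv)
    exact ⟨c, d, hz⟩
  by_cases hz : ∃ z, (underG T).Adj x z ∧ z ∉ P.support
  · obtain ⟨z, hxz, hz⟩ := hz
    obtain ⟨S, c, d, h, -, h1, h2⟩ := ZigzagOn.extend_along (Q := P.support.toFinset) hT P hP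
      (by simp) (ZigzagOn.base hxz) (by
        intro v hv hm
        rcases mem_insert.1 hm with hm | hm
        · exact hm
        · exact (hz (mem_singleton.1 hm ▸ hv)).elim)
    exact ⟨S, c, d, h, h1, h2⟩
  · push Not at hz
    cases P with
    | nil =>
      obtain ⟨z, hxz⟩ := htree.connected.preconnected.exists_adj_of_nontrivial x
      have := hz z hxz
      simp only [SimpleGraph.Walk.support_nil, List.mem_singleton] at this
      exact (hxz.ne this.symm).elim
    | @cons _ x₁ _ hadj P =>
      rw [SimpleGraph.Walk.cons_isPath_iff] at hP
      obtain ⟨S, c, d, h, hsub, h1, h2⟩ := ZigzagOn.extend_along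
        (Q := (SimpleGraph.Walk.cons hadj P).support.toFinset) hT P hP.1
        (by simp +contextual) (ZigzagOn.base hadj).symm (by
          intro v hv hm
          rcases mem_insert.1 hm with hm | hm
          · exact (hP.2 (hm ▸ hv)).elim
          · exact mem_singleton.1 hm)
      refine ⟨S, c, d, h, ?_, ?_⟩
      · simp only [SimpleGraph.Walk.support_cons, List.mem_cons, forall_eq_or_imp]
        exact ⟨hsub (by simp), h1⟩
      · intro w hw v hv hvQ
        rw [SimpleGraph.Walk.support_cons, List.mem_cons] at hw
        rcases hw with rfl | hw
        · exact (hvQ (List.mem_toFinset.2 (hz v hv.symm))).elim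
        · exact h2 w hw v hv hvQ

theorem IsCaterpillarG.exists_zigzag_univ [Fintype W] [Nontrivial W] (hT : Antidirected T)
    (hcat : IsCaterpillarG (underG T)) :
    ∃ F a b s t, Zigzag T univ F a b s t ∧ ∀ x y, T x y → (x, y) ∈ F := by
  obtain ⟨c, d, F, s, t, h⟩ := hcat.exists_zigzagOn_univ hT
  obtain ⟨a, b, h⟩ : ∃ a b, Zigzag T univ F a b s t := h.elim (⟨_, _, ·⟩) (⟨_, _, ·⟩)
  refine ⟨F, a, b, s, t, h, fun x y hxy => ?_⟩
  have hF : F = univ.filter fun p : W × W => T p.1 p.2 := by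
    refine eq_of_subset_of_card_le (fun p hp => by simpa using (h.mem.2.2 p hp).1) ?_
    have h1 := hT.arcCount_lt_card hcat.1
    have h2 := h.card hT
    rw [card_univ] at h2
    unfold arcCount at h1
    omega
  simp [hF, hxy]

end Spanning

end Caterpillar

/-- If `a(D) > (k−1)(|D⁺|+|D⁻|)/2` and the parts of `D` and of the
antidirected caterpillar `T` with `k` arcs are compatibly ordered, then `T` embeds in `D`. -/
theorem stmt_7 (n k : ℕ) (hn : 0 < n) (hk : 0 < k)
    {V : Type*} [Fintype V] [DecidableEq V]
    (D : V → V → Bool) (hloop : Loopless D) (hcard : Fintype.card V = n)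
    (harcs : (k - 1) * ((outVerts D).card + (inVerts D).card) < 2 * arcCount D)
    {W : Type*} [Fintype W] [DecidableEq W]
    (T : W → W → Bool) (hT : Antidirected T)
    (hcat : IsCaterpillarG (underG T)) (hkT : arcCount T = k)
    (hside :
      ((outVerts D).card ≤ (inVerts D).card ∧ (outVerts T).card ≤ (inVerts T).card) ∨
      ((inVerts D).card ≤ (outVerts D).card ∧ (inVerts T).card ≤ (outVerts T).card)) :
    Embeds T D := by
  obtain ⟨p, hp⟩ : ((univ : Finset (W × W)).filter fun p => T p.1 p.2).Nonempty := by
    rw [← card_pos]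
    exact hk.trans_eq hkT.symm
  have hp : T p.1 p.2 := (mem_filter.1 hp).2
  have : Nontrivial W := ⟨p.1, p.2, fun h => hT _ _ _ hp (h ▸ hp)⟩
  obtain ⟨F, a, b, s, t, h, hF⟩ := hcat.exists_zigzag_univ hT
  have hcount := h.arcCount_le (e := Fintype.equivFinOfCardEq hcard) hT hloop
  obtain ⟨h1, h2, h3, -⟩ := h.card hT
  rw [univ_inter] at h1 h2
  have hks : s + t ≤ k - 1 := by
    have : F.card ≤ arcCount T :=
      card_le_card fun p hp => by simpa using (h.mem.2.2 p hp).1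
    omega
  have hlt : s * (inVerts D).card + t * (outVerts D).card < arcCount D := by
    have hle := Nat.mul_le_mul_right ((outVerts D).card + (inVerts D).card) hks
    rw [h1, h2] at hside
    rcases hside with ⟨hd, hst⟩ | ⟨hd, hst⟩
    · obtain ⟨i, hi⟩ := Nat.exists_eq_add_of_le hd
      obtain ⟨j, rfl⟩ := Nat.exists_eq_add_of_le (Nat.le_of_succ_le_succ hst)
      rw [hi] at hle harcs ⊢
      nlinarith [Nat.zero_le (i * j)]
    · obtain ⟨i, hi⟩ := Nat.exists_eq_add_of_le hd
      obtain ⟨j, rfl⟩ := Nat.exists_eq_add_of_le (Nat.le_of_succ_le_succ hst)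
      rw [hi] at hle harcs ⊢
      nlinarith [Nat.zero_le (i * j)]
  obtain ⟨⟨u, v⟩, hg⟩ := card_pos.1 (show 0 < (goodPairs (Fintype.equivFinOfCardEq hcard) D univ F a b).card by omega)
  obtain ⟨-, f, hf, hfF, -⟩ := mem_goodPairs.1 hg
  exact ⟨f, fun x y hxy => hf (by simp) (by simp) hxy, fun x y hxy => hfF _ (hF x y hxy)⟩
end
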